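/- Let n ≥ 9 be an integer and p = (n+8)/(n−8). If u : ℝⁿ → ℝ is a C^∞ solution of Δ⁴u = |u|^{p−1}u on ℝⁿ that is stable outside a compact set, then u has finite energy; more precisely, ∫_{ℝⁿ} |Δ²u|² dx and ∫_{ℝⁿ} |u|^{p+1} dx are both finite and ∫_{ℝⁿ} |Δ²u|² dx = ∫_{ℝⁿ} |u|^{p+1} dx. -/

import Mathlib

open MeasureTheory Real

noncomputable def lap {n : ℕ} (f : EuclideanSpace ℝ (Fin n) → ℝ) :
    EuclideanSpace ℝ (Fin n) → ℝ :=
  fun x => ∑ i : Fin n,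
    iteratedFDeriv ℝ 2 f x ![EuclideanSpace.single i 1, EuclideanSpace.single i 1]

/-- The partial derivative in the `i`-th coordinate direction. -/
noncomputable def pd {n : ℕ} (i : Fin n) (f : EuclideanSpace ℝ (Fin n) → ℝ) :
    EuclideanSpace ℝ (Fin n) → ℝ :=
  fun x => fderiv ℝ f x (EuclideanSpace.single i 1)

section Calculus

variable {n : ℕ} {f g : EuclideanSpace ℝ (Fin n) → ℝ}

lemma ContDiff.differentiable_top (hf : ContDiff ℝ (⊤ : ℕ∞) f) : Differentiable ℝ f :=
  hf.differentiable (by simp)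

lemma contDiff_pd (i : Fin n) (hf : ContDiff ℝ (⊤ : ℕ∞) f) : ContDiff ℝ (⊤ : ℕ∞) (pd i f) :=
  (hf.fderiv_right (m := (⊤ : ℕ∞)) (by simp)).clm_apply contDiff_const

lemma pd_add (i : Fin n) (hf : ContDiff ℝ (⊤ : ℕ∞) f) (hg : ContDiff ℝ (⊤ : ℕ∞) g) :
    pd i (fun x => f x + g x) = fun x => pd i f x + pd i g x := by
  funext x
  simp only [pd]
  rw [fderiv_fun_add (hf.differentiable_top x) (hg.differentiable_top x)]
  rfl

lemma pd_const_mul (i : Fin n) (c : ℝ) (hf : ContDiff ℝ (⊤ : ℕ∞) f) :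
    pd i (fun x => c * f x) = fun x => c * pd i f x := by
  funext x
  simp only [pd]
  rw [fderiv_const_mul (hf.differentiable_top x)]
  rfl

lemma pd_mul (i : Fin n) (hf : ContDiff ℝ (⊤ : ℕ∞) f) (hg : ContDiff ℝ (⊤ : ℕ∞) g) :
    pd i (fun x => f x * g x) = fun x => pd i f x * g x + f x * pd i g x := by
  funext x
  simp only [pd]
  rw [fderiv_fun_mul (hf.differentiable_top x) (hg.differentiable_top x)]
  simp
  ring

lemma pd_sum {ι : Type*} (s : Finset ι) (i : Fin n) {F : ι → EuclideanSpace ℝ (Fin n) → ℝ}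
    (hF : ∀ j, ContDiff ℝ (⊤ : ℕ∞) (F j)) :
    pd i (fun x => ∑ j ∈ s, F j x) = fun x => ∑ j ∈ s, pd i (F j) x := by
  funext x
  simp only [pd]
  rw [fderiv_fun_sum (fun j _ => (hF j).differentiable_top x)]
  simp

lemma pd_pd_apply (i j : Fin n) (hf : ContDiff ℝ (⊤ : ℕ∞) f) (x : EuclideanSpace ℝ (Fin n)) :
    pd i (pd j f) x =
      fderiv ℝ (fderiv ℝ f) x (EuclideanSpace.single i 1) (EuclideanSpace.single j 1) := by
  have hd : DifferentiableAt ℝ (fderiv ℝ f) x :=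
    (hf.fderiv_right (m := (⊤ : ℕ∞)) (by simp)).differentiable (by simp) x
  change fderiv ℝ (fun y => fderiv ℝ f y (EuclideanSpace.single j 1)) x _ = _
  rw [fderiv_clm_apply hd (by fun_prop)]
  simp

lemma pd_comm (i j : Fin n) (hf : ContDiff ℝ (⊤ : ℕ∞) f) : pd i (pd j f) = pd j (pd i f) := by
  funext x
  rw [pd_pd_apply i j hf, pd_pd_apply j i hf]
  have := (hf.contDiffAt (x := x)).isSymmSndFDerivAt
    (by simpa using WithTop.coe_le_coe.2 (le_top : (2 : ℕ∞) ≤ ⊤))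
  exact this _ _

lemma lap_eq (hf : ContDiff ℝ (⊤ : ℕ∞) f) : lap f = fun x => ∑ i, pd i (pd i f) x := by
  funext x
  refine Finset.sum_congr rfl fun i _ => ?_
  rw [iteratedFDeriv_two_apply, pd_pd_apply i i hf]
  simp

lemma contDiff_lap (hf : ContDiff ℝ (⊤ : ℕ∞) f) : ContDiff ℝ (⊤ : ℕ∞) (lap f) := by
  rw [lap_eq hf]
  exact ContDiff.sum fun i _ => contDiff_pd i (contDiff_pd i hf)

lemma pd_lap (i : Fin n) (hf : ContDiff ℝ (⊤ : ℕ∞) f) : pd i (lap f) = lap (pd i f) := by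
  rw [lap_eq hf, lap_eq (contDiff_pd i hf), pd_sum _ _ fun j => contDiff_pd j (contDiff_pd j hf)]
  funext x
  refine Finset.sum_congr rfl fun j _ => ?_
  rw [pd_comm i j (contDiff_pd j hf), pd_comm i j hf]

lemma lap_add (hf : ContDiff ℝ (⊤ : ℕ∞) f) (hg : ContDiff ℝ (⊤ : ℕ∞) g) :
    lap (fun x => f x + g x) = fun x => lap f x + lap g x := by
  rw [lap_eq hf, lap_eq hg, lap_eq (hf.add hg)]
  funext x
  rw [← Finset.sum_add_distrib]
  refine Finset.sum_congr rfl fun i _ => ?_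
  rw [pd_add i hf hg, pd_add i (contDiff_pd i hf) (contDiff_pd i hg)]

lemma lap_const_mul (c : ℝ) (hf : ContDiff ℝ (⊤ : ℕ∞) f) :
    lap (fun x => c * f x) = fun x => c * lap f x := by
  rw [lap_eq hf, lap_eq (contDiff_const.mul hf)]
  funext x
  rw [Finset.mul_sum]
  refine Finset.sum_congr rfl fun i _ => ?_
  rw [pd_const_mul i c hf, pd_const_mul i c (contDiff_pd i hf)]

lemma lap_sum {ι : Type*} (s : Finset ι) {F : ι → EuclideanSpace ℝ (Fin n) → ℝ}
    (hF : ∀ j, ContDiff ℝ (⊤ : ℕ∞) (F j)) :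
    lap (fun x => ∑ j ∈ s, F j x) = fun x => ∑ j ∈ s, lap (F j) x := by
  rw [lap_eq (ContDiff.sum fun j _ => hF j)]
  funext x
  simp_rw [fun j => lap_eq (hF j)]
  rw [Finset.sum_comm]
  refine Finset.sum_congr rfl fun i _ => ?_
  rw [pd_sum s i hF, pd_sum s i fun j => contDiff_pd i (hF j)]

lemma lap_mul (hf : ContDiff ℝ (⊤ : ℕ∞) f) (hg : ContDiff ℝ (⊤ : ℕ∞) g) :
    lap (fun x => f x * g x) =
      fun x => lap f x * g x + 2 * (∑ i, pd i f x * pd i g x) + f x * lap g x := by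
  rw [lap_eq hf, lap_eq hg, lap_eq (hf.mul hg)]
  funext x
  simp only [Finset.mul_sum, Finset.sum_mul, ← Finset.sum_add_distrib]
  refine Finset.sum_congr rfl fun i _ => ?_
  have hfi := contDiff_pd i hf
  have hgi := contDiff_pd i hg
  rw [pd_mul i hf hg, pd_add i (hfi.mul hg) (hf.mul hgi), pd_mul i hfi hg, pd_mul i hf hgi]
  ring

/-- The Leibniz formula for the bilaplacian of a product. -/
lemma lap_lap_mul (hf : ContDiff ℝ (⊤ : ℕ∞) f) (hg : ContDiff ℝ (⊤ : ℕ∞) g)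
    (x : EuclideanSpace ℝ (Fin n)) :
    lap (lap (fun x => f x * g x)) x = f x * lap (lap g) x + (
      4 * (∑ i, pd i f x * pd i (lap g) x) + 2 * lap f x * lap g x
      + 4 * (∑ i, ∑ j, pd j (pd i f) x * pd j (pd i g) x)
      + 4 * (∑ i, pd i (lap f) x * pd i g x) + lap (lap f) x * g x) := by
  have hlf := contDiff_lap hf
  have hlg := contDiff_lap hg
  have hp : ∀ i, ContDiff ℝ (⊤ : ℕ∞) fun x => pd i f x * pd i g x :=
    fun i => (contDiff_pd i hf).mul (contDiff_pd i hg)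
  have hs : ContDiff ℝ (⊤ : ℕ∞) fun x => ∑ i, pd i f x * pd i g x := ContDiff.sum fun i _ => hp i
  rw [lap_mul hf hg, lap_add ((hlf.mul hg).add (contDiff_const.mul hs)) (hf.mul hlg),
    lap_add (hlf.mul hg) (contDiff_const.mul hs), lap_mul hlf hg, lap_mul hf hlg,
    lap_const_mul 2 hs, lap_sum _ hp]
  simp only [fun i => lap_mul (contDiff_pd i hf) (contDiff_pd i hg), Finset.sum_add_distrib,
    ← pd_lap _ hf, ← pd_lap _ hg, ← Finset.mul_sum]
  ring

lemma lap_congr_nhds {x : EuclideanSpace ℝ (Fin n)} (h : f =ᶠ[nhds x] g) :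
    lap f =ᶠ[nhds x] lap g := by
  filter_upwards [h.iteratedFDeriv ℝ 2] with y hy
  simp only [lap, hy]

lemma lap_lap_congr_nhds {x : EuclideanSpace ℝ (Fin n)} (h : f =ᶠ[nhds x] g) :
    lap (lap f) x = lap (lap g) x :=
  (lap_congr_nhds (lap_congr_nhds h)).eq_of_nhds

lemma pd_comp_smul (i : Fin n) (c : ℝ) (f : EuclideanSpace ℝ (Fin n) → ℝ) :
    pd i (fun x => f (c • x)) = fun x => c * pd i f (c • x) := by
  funext x
  simp only [pd]
  rw [fderiv_comp_smul]
  simp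

lemma HasCompactSupport.pd (i : Fin n) (hf : HasCompactSupport f) : HasCompactSupport (pd i f) :=
  hf.fderiv_apply ℝ _

lemma integral_pd_mul (i : Fin n) (hf : ContDiff ℝ (⊤ : ℕ∞) f) (hg : ContDiff ℝ (⊤ : ℕ∞) g)
    (hc : HasCompactSupport g) : ∫ x, pd i f x * g x = -∫ x, f x * pd i g x := by
  have h := integral_mul_fderiv_eq_neg_fderiv_mul_of_integrable (𝕜 := ℝ) (f := f) (g := g)
    (μ := volume) (v := EuclideanSpace.single i 1)
    (((contDiff_pd i hf).continuous.mul hg.continuous).integrable_of_hasCompactSupport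
      hc.mul_left)
    ((hf.continuous.mul (contDiff_pd i hg).continuous).integrable_of_hasCompactSupport
      (hc.pd i).mul_left)
    ((hf.continuous.mul hg.continuous).integrable_of_hasCompactSupport hc.mul_left)
    (fun x _ => hf.differentiable_top x) (fun x _ => hg.differentiable_top x)
  simp only [pd]
  linarith

lemma HasCompactSupport.lap (hf : ContDiff ℝ (⊤ : ℕ∞) f) (hc : HasCompactSupport f) :
    HasCompactSupport (lap f) := by
  rw [lap_eq hf]
  refine hc.mono' fun x hx => ?_
  by_contra hx'
  refine hx (Finset.sum_eq_zero fun i _ => ?_)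
  have h0 : f =ᶠ[nhds x] 0 := notMem_tsupport_iff_eventuallyEq.1 hx'
  have h1 : ∀ g : EuclideanSpace ℝ (Fin n) → ℝ, g =ᶠ[nhds x] 0 → _root_.pd i g =ᶠ[nhds x] 0 := by
    intro g hg
    filter_upwards [hg.fderiv (𝕜 := ℝ)] with y hy
    simp [_root_.pd, hy]
  exact (h1 _ (h1 _ h0)).eq_of_nhds

lemma integral_lap_mul (hf : ContDiff ℝ (⊤ : ℕ∞) f) (hg : ContDiff ℝ (⊤ : ℕ∞) g)
    (hc : HasCompactSupport g) : ∫ x, lap f x * g x = ∫ x, f x * lap g x := by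
  rw [lap_eq hf, lap_eq hg]
  simp only [Finset.sum_mul, Finset.mul_sum]
  rw [integral_finsetSum, integral_finsetSum]
  · refine Finset.sum_congr rfl fun i _ => ?_
    rw [integral_pd_mul i (contDiff_pd i hf) hg hc,
      ← neg_inj, neg_neg, ← integral_pd_mul i hf (contDiff_pd i hg) (hc.pd i)]
  · intro i _
    exact (hf.continuous.mul (contDiff_pd i (contDiff_pd i hg)).continuous
      ).integrable_of_hasCompactSupport ((hc.pd i).pd i).mul_left
  · intro i _
    exact ((contDiff_pd i (contDiff_pd i hf)).continuous.mul hg.continuous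
      ).integrable_of_hasCompactSupport hc.mul_left

end Calculus

/-- A smooth compactly supported cutoff function with values in `[0, 1]`. -/
structure IsCutoff {n : ℕ} (χ : EuclideanSpace ℝ (Fin n) → ℝ) : Prop where
  smooth : ContDiff ℝ (⊤ : ℕ∞) χ
  compact : HasCompactSupport χ
  nonneg : ∀ x, 0 ≤ χ x
  le_one : ∀ x, χ x ≤ 1

/-- `F` is the product of `χ ^ k` and a smooth function. -/
def PowDvd {n : ℕ} (χ : EuclideanSpace ℝ (Fin n) → ℝ) (k : ℕ)
    (F : EuclideanSpace ℝ (Fin n) → ℝ) : Prop :=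
  ∃ g : EuclideanSpace ℝ (Fin n) → ℝ, ContDiff ℝ (⊤ : ℕ∞) g ∧ F = fun x => χ x ^ k * g x

section Cutoff

variable {n : ℕ} {χ : EuclideanSpace ℝ (Fin n) → ℝ} {F : EuclideanSpace ℝ (Fin n) → ℝ}

lemma PowDvd.smooth {k : ℕ} (hχ : IsCutoff χ) (hF : PowDvd χ k F) : ContDiff ℝ (⊤ : ℕ∞) F := by
  obtain ⟨g, hg, rfl⟩ := hF
  exact (hχ.smooth.pow k).mul hg

lemma powDvd_pow (k : ℕ) : PowDvd χ k (fun x => χ x ^ k) :=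
  ⟨fun _ => 1, contDiff_const, by simp⟩

lemma pd_pow_succ (i : Fin n) (k : ℕ) (hχ : ContDiff ℝ (⊤ : ℕ∞) χ) :
    pd i (fun x => χ x ^ (k + 1)) = fun x => χ x ^ k * ((k + 1) * pd i χ x) := by
  funext x
  simp only [pd]
  rw [fderiv_fun_pow _ (hχ.differentiable_top x)]
  simp
  ring

lemma PowDvd.pd {k : ℕ} (i : Fin n) (hχ : IsCutoff χ) (hF : PowDvd χ (k + 1) F) :
    PowDvd χ k (pd i F) := by
  obtain ⟨g, hg, rfl⟩ := hF
  refine ⟨fun x => (k + 1) * _root_.pd i χ x * g x + χ x * _root_.pd i g x, ?_, ?_⟩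
  · exact ((contDiff_const.mul (contDiff_pd i hχ.smooth)).mul hg).add
      (hχ.smooth.mul (contDiff_pd i hg))
  · rw [pd_mul i (hχ.smooth.pow _) hg, pd_pow_succ i k hχ.smooth]
    funext x
    ring

lemma PowDvd.sum {ι : Type*} (s : Finset ι) {k : ℕ} {G : ι → EuclideanSpace ℝ (Fin n) → ℝ}
    (hG : ∀ i, PowDvd χ k (G i)) : PowDvd χ k (fun x => ∑ i ∈ s, G i x) := by
  choose g hg h using hG
  refine ⟨fun x => ∑ i ∈ s, g i x, ContDiff.sum fun i _ => hg i, ?_⟩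
  funext x
  rw [Finset.mul_sum]
  exact Finset.sum_congr rfl fun i _ => by rw [h i]

lemma PowDvd.lap {k : ℕ} (hχ : IsCutoff χ) (hF : PowDvd χ (k + 2) F) : PowDvd χ k (lap F) := by
  rw [lap_eq (hF.smooth hχ)]
  exact PowDvd.sum _ fun i => (hF.pd i hχ).pd i hχ

lemma PowDvd.bound {k : ℕ} (hk : 1 ≤ k) (hχ : IsCutoff χ) (hF : PowDvd χ k F) :
    ∃ C, ∀ x, |F x| ≤ C * χ x ^ k := by
  obtain ⟨g, hg, rfl⟩ := hF
  obtain ⟨C, hC⟩ := hχ.compact.exists_bound_of_continuousOn hg.continuous.continuousOn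
  refine ⟨C, fun x => ?_⟩
  by_cases hx : x ∈ tsupport χ
  · rw [abs_mul, abs_of_nonneg (pow_nonneg (hχ.nonneg x) k), mul_comm]
    exact mul_le_mul_of_nonneg_right (hC x hx) (pow_nonneg (hχ.nonneg x) k)
  · simp [image_eq_zero_of_notMem_tsupport hx, Nat.one_le_iff_ne_zero.1 hk]

lemma exists_uniform_bound {ι X : Type*} [Fintype ι] {G : ι → X → ℝ} {b : X → ℝ}
    (hb : ∀ x, 0 ≤ b x) (h : ∀ i, ∃ C, ∀ x, |G i x| ≤ C * b x) :
    ∃ C, ∀ i x, |G i x| ≤ C * b x := by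
  choose C hC using h
  refine ⟨∑ i, |C i|, fun i x => (hC i x).trans ?_⟩
  refine mul_le_mul_of_nonneg_right ((le_abs_self _).trans ?_) (hb x)
  exact Finset.single_le_sum (f := fun i => |C i|) (fun _ _ => abs_nonneg _) (Finset.mem_univ i)

lemma contDiff_comp_smul (c : ℝ) (hF : ContDiff ℝ (⊤ : ℕ∞) F) :
    ContDiff ℝ (⊤ : ℕ∞) fun x => F (c • x) :=
  hF.comp (contDiff_const_smul c)

lemma lap_comp_smul (c : ℝ) (hF : ContDiff ℝ (⊤ : ℕ∞) F) :
    lap (fun x => F (c • x)) = fun x => c ^ 2 * lap F (c • x) := by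
  rw [lap_eq hF, lap_eq (contDiff_comp_smul c hF)]
  funext x
  rw [Finset.mul_sum]
  refine Finset.sum_congr rfl fun i _ => ?_
  rw [pd_comp_smul, pd_const_mul i c (contDiff_comp_smul c (contDiff_pd i hF)),
    pd_comp_smul]
  ring

/-- Derivative bounds for the rescalings of a function divisible by a power of a cutoff. -/
lemma PowDvd.exists_bounds {G : EuclideanSpace ℝ (Fin n) → ℝ} (hχ : IsCutoff χ) {k : ℕ}
    (hk : 1 ≤ k) (hG : PowDvd χ (k + 4) G) :
    ∃ C, 0 ≤ C ∧ ∀ c : ℝ, 0 < c → ∀ x,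
      (∀ i, |_root_.pd i (fun y => G (c • y)) x| ≤ C * (c * χ (c • x) ^ (k + 3))) ∧
      (∀ i j, |_root_.pd j (_root_.pd i (fun y => G (c • y))) x|
        ≤ C * (c ^ 2 * χ (c • x) ^ (k + 2))) ∧
      |_root_.lap (fun y => G (c • y)) x| ≤ C * (c ^ 2 * χ (c • x) ^ (k + 2)) ∧
      (∀ i, |_root_.pd i (_root_.lap (fun y => G (c • y))) x|
        ≤ C * (c ^ 3 * χ (c • x) ^ (k + 1))) ∧
      |_root_.lap (_root_.lap (fun y => G (c • y))) x| ≤ C * (c ^ 4 * χ (c • x) ^ k) := by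
  have hGs := hG.smooth hχ
  have hb : ∀ j x, 0 ≤ χ x ^ j := fun j x => pow_nonneg (hχ.nonneg x) j
  obtain ⟨C₁, h₁⟩ := exists_uniform_bound (G := fun i => _root_.pd i G) (hb (k + 3))
    fun i => (hG.pd i hχ).bound (by omega) hχ
  obtain ⟨C₂, h₂⟩ := exists_uniform_bound
    (G := fun q : Fin n × Fin n => _root_.pd q.2 (_root_.pd q.1 G))
    (hb (k + 2)) fun q => ((hG.pd q.1 hχ).pd q.2 hχ).bound (by omega) hχ
  have hL : PowDvd χ (k + 2) (_root_.lap G) := PowDvd.lap hχ hG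
  obtain ⟨C₃, h₃⟩ := hL.bound (by omega) hχ
  obtain ⟨C₄, h₄⟩ := exists_uniform_bound (G := fun i => _root_.pd i (_root_.lap G)) (hb (k + 1))
    fun i => (hL.pd i hχ).bound (by omega) hχ
  obtain ⟨C₅, h₅⟩ := (PowDvd.lap hχ hL).bound hk hχ
  obtain ⟨C, hC, l₁, l₂, l₃, l₄, l₅⟩ :
      ∃ C, 0 ≤ C ∧ C₁ ≤ C ∧ C₂ ≤ C ∧ C₃ ≤ C ∧ C₄ ≤ C ∧ C₅ ≤ C := by
    have := le_abs_self C₁; have := le_abs_self C₂; have := le_abs_self C₃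
    have := le_abs_self C₄; have := le_abs_self C₅
    have := abs_nonneg C₁; have := abs_nonneg C₂; have := abs_nonneg C₃
    have := abs_nonneg C₄; have := abs_nonneg C₅
    refine ⟨|C₁| + |C₂| + |C₃| + |C₄| + |C₅|, ?_, ?_, ?_, ?_, ?_, ?_⟩ <;> linarith
  have key : ∀ {a D : ℝ} (d : ℝ) (j : ℕ) (x : EuclideanSpace ℝ (Fin n)), 0 ≤ d → D ≤ C →
      |a| ≤ D * χ x ^ j → |d * a| ≤ C * (d * χ x ^ j) := by
    intro a D d j x hd hD h
    rw [abs_mul, abs_of_nonneg hd]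
    have := mul_le_mul_of_nonneg_left (h.trans (mul_le_mul_of_nonneg_right hD (hb j x))) hd
    linarith
  refine ⟨C, hC, fun c hc x => ?_⟩
  have hcs : ContDiff ℝ (⊤ : ℕ∞) fun y => _root_.lap G (c • y) :=
    contDiff_comp_smul c (contDiff_lap hGs)
  rw [lap_comp_smul c hGs]
  simp only [pd_comp_smul _ c G]
  refine ⟨fun i => ?_, fun i j => ?_, ?_, fun i => ?_, ?_⟩
  · exact key c (k + 3) (c • x) hc.le l₁ (h₁ i _)
  · rw [pd_const_mul j c (contDiff_comp_smul c (contDiff_pd i hGs)),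
      pd_comp_smul j c (_root_.pd i G)]
    dsimp only
    rw [← mul_assoc, ← sq]
    exact key _ (k + 2) (c • x) (by positivity) l₂ (h₂ (i, j) _)
  · exact key _ (k + 2) (c • x) (by positivity) l₃ (h₃ _)
  · rw [pd_const_mul i _ hcs, pd_comp_smul i c (_root_.lap G)]
    dsimp only
    rw [← mul_assoc, ← pow_succ]
    exact key _ (k + 1) (c • x) (by positivity) l₄ (h₄ i _)
  · rw [lap_const_mul _ hcs, lap_comp_smul c (contDiff_lap hGs)]
    dsimp only
    rw [← mul_assoc, ← pow_add]
    exact key _ k (c • x) (by positivity) l₅ (h₅ _)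

lemma IsCutoff.contDiff_smul_pow (hχ : IsCutoff χ) (c : ℝ) (k : ℕ) :
    ContDiff ℝ (⊤ : ℕ∞) fun x => χ (c • x) ^ k :=
  (contDiff_comp_smul c hχ.smooth).pow k

lemma IsCutoff.hasCompactSupport_smul_pow (hχ : IsCutoff χ) {c : ℝ} (hc : 0 < c) {k : ℕ}
    (hk : 1 ≤ k) : HasCompactSupport fun x => χ (c • x) ^ k := by
  refine (hχ.compact.comp_smul hc.ne').comp_left (g := fun t : ℝ => t ^ k) ?_
  simp [Nat.one_le_iff_ne_zero.1 hk]

lemma IsCutoff.integrable_mul (hχ : IsCutoff χ) {c : ℝ} (hc : 0 < c) {k : ℕ} (hk : 1 ≤ k)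
    {h : EuclideanSpace ℝ (Fin n) → ℝ} (hh : Continuous h) :
    Integrable fun x => χ (c • x) ^ k * h x :=
  ((hχ.contDiff_smul_pow c k).continuous.mul hh).integrable_of_hasCompactSupport
    (hχ.hasCompactSupport_smul_pow hc hk).mul_right

end Cutoff

lemma integral_le_of_le_linear_comb {X : Type*} [MeasurableSpace X] {μ : Measure X}
    {F f₁ f₂ f₃ : X → ℝ} {a₁ a₂ a₃ : ℝ} (hF : Integrable F μ) (h₁ : Integrable f₁ μ)
    (h₂ : Integrable f₂ μ) (h₃ : Integrable f₃ μ)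
    (h : ∀ x, F x ≤ a₁ * f₁ x + a₂ * f₂ x + a₃ * f₃ x) :
    ∫ x, F x ∂μ ≤ a₁ * (∫ x, f₁ x ∂μ) + a₂ * (∫ x, f₂ x ∂μ) + a₃ * ∫ x, f₃ x ∂μ := by
  have i₁₂ : Integrable (fun x => a₁ * f₁ x + a₂ * f₂ x) μ :=
    (h₁.const_mul a₁).add (h₂.const_mul a₂)
  have hI := integral_mono hF (i₁₂.add (h₃.const_mul a₃)) h
  rw [integral_add' i₁₂ (h₃.const_mul a₃), integral_add (h₁.const_mul a₁) (h₂.const_mul a₂)] at hI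
  simpa only [integral_const_mul] using hI

section Interpolation

variable {n : ℕ} {χ : EuclideanSpace ℝ (Fin n) → ℝ}

lemma IsCutoff.exists_pd_bound (hχ : IsCutoff χ) {k : ℕ} (hk : 1 ≤ k) :
    ∃ C, ∀ c : ℝ, 0 < c → ∀ i x,
      |pd i (fun y => χ (c • y) ^ (k + 1)) x| ≤ C * (c * χ (c • x) ^ k) := by
  have hG : PowDvd χ (k + 1) (fun x => χ x ^ (k + 1)) := powDvd_pow _
  obtain ⟨C, hC⟩ := exists_uniform_bound (G := fun i => pd i (fun x => χ x ^ (k + 1)))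
    (fun x => pow_nonneg (hχ.nonneg x) k) fun i => (hG.pd i hχ).bound hk hχ
  refine ⟨C, fun c hc i x => ?_⟩
  rw [pd_comp_smul i c (fun x => χ x ^ (k + 1))]
  dsimp only
  rw [abs_mul, abs_of_pos hc]
  have := mul_le_mul_of_nonneg_left (hC i (c • x)) hc.le
  linarith

/-- The Green identity with a weight. -/
lemma integral_weight_mul_sum_pd_sq {η f : EuclideanSpace ℝ (Fin n) → ℝ}
    (hη : ContDiff ℝ (⊤ : ℕ∞) η) (hc : HasCompactSupport η) (hf : ContDiff ℝ (⊤ : ℕ∞) f) :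
    ∫ x, η x * ∑ i, pd i f x ^ 2 =
      ∫ x, -(η x * (f x * lap f x)) - ∑ i, pd i η x * (f x * pd i f x) := by
  have hη' := hη.continuous
  have hf' := hf.continuous
  have hpη : ∀ i, Continuous (pd i η) := fun i => (contDiff_pd i hη).continuous
  have hpf : ∀ i, Continuous (pd i f) := fun i => (contDiff_pd i hf).continuous
  have hppf : ∀ i, Continuous (pd i (pd i f)) :=
    fun i => (contDiff_pd i (contDiff_pd i hf)).continuous
  have h1 : ∀ i, Integrable fun x => η x * (f x * pd i (pd i f) x) := fun i =>
    (hη'.mul (hf'.mul (hppf i))).integrable_of_hasCompactSupport hc.mul_right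
  have h1n : ∀ i, Integrable fun x => -(η x * (f x * pd i (pd i f) x)) := fun i => (h1 i).neg
  have h2 : ∀ i, Integrable fun x => pd i η x * (f x * pd i f x) := fun i =>
    ((hpη i).mul (hf'.mul (hpf i))).integrable_of_hasCompactSupport (hc.pd i).mul_right
  have h4 : ∀ i, Integrable fun x =>
      -(η x * (f x * pd i (pd i f) x)) - pd i η x * (f x * pd i f x) :=
    fun i => (h1n i).sub (h2 i)
  have h3 : ∀ i, Integrable fun x => η x * pd i f x ^ 2 := fun i =>
    (hη'.mul ((hpf i).pow 2)).integrable_of_hasCompactSupport hc.mul_right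
  have key : ∀ i, ∫ x, η x * pd i f x ^ 2 =
      ∫ x, (-(η x * (f x * pd i (pd i f) x)) - pd i η x * (f x * pd i f x)) := by
    intro i
    have h := integral_pd_mul i (contDiff_pd i hf) (hη.mul hf) hc.mul_right
    rw [pd_mul i hη hf] at h
    have e1 : ∫ x, pd i (pd i f) x * (η x * f x) = ∫ x, η x * (f x * pd i (pd i f) x) :=
      integral_congr_ae (.of_forall fun x => by ring)
    have e2 : ∫ x, pd i f x * (pd i η x * f x + η x * pd i f x) =
        (∫ x, pd i η x * (f x * pd i f x)) + ∫ x, η x * pd i f x ^ 2 := by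
      rw [← integral_add (h2 i) (h3 i)]
      exact integral_congr_ae (.of_forall fun x => by ring)
    rw [integral_sub (h1n i) (h2 i), integral_neg]
    linarith
  simp only [lap_eq hf, Finset.mul_sum, ← Finset.sum_neg_distrib, ← Finset.sum_sub_distrib]
  rw [integral_finsetSum _ fun i _ => h3 i,
    integral_finsetSum _ fun i _ => h4 i]
  exact Finset.sum_congr rfl fun i _ => key i

/-- A weighted interpolation inequality for first derivatives. -/
lemma IsCutoff.interpolation (hχ : IsCutoff χ) {s : ℕ} (hs : 1 ≤ s) {ε : ℝ} (hε : 0 < ε) :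
    ∃ C, 0 ≤ C ∧ ∀ c : ℝ, 0 < c → ∀ f : EuclideanSpace ℝ (Fin n) → ℝ, ContDiff ℝ (⊤ : ℕ∞) f →
      c ^ 2 * ∫ x, χ (c • x) ^ (2 * s + 2) * ∑ i, pd i f x ^ 2 ≤
        ε * (∫ x, χ (c • x) ^ (2 * s + 4) * lap f x ^ 2) +
          C * (c ^ 4 * ∫ x, χ (c • x) ^ (2 * s) * f x ^ 2) := by
  obtain ⟨D, hD⟩ := hχ.exists_pd_bound (k := 2 * s + 1) (by omega)
  refine ⟨1 / ε + n * D ^ 2, by positivity, fun c hc f hf => ?_⟩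
  have hlf := contDiff_lap hf
  have i1 : Integrable fun x => χ (c • x) ^ (2 * s + 2) * ∑ i, pd i f x ^ 2 :=
    hχ.integrable_mul hc (by omega)
      (continuous_finsetSum _ fun i _ => (contDiff_pd i hf).continuous.pow 2)
  have i2 : Integrable fun x => χ (c • x) ^ (2 * s + 4) * lap f x ^ 2 :=
    hχ.integrable_mul hc (by omega) (hlf.continuous.pow 2)
  have i3 : Integrable fun x => χ (c • x) ^ (2 * s) * f x ^ 2 :=
    hχ.integrable_mul hc (by omega) (hf.continuous.pow 2)
  have hη := hχ.contDiff_smul_pow c (2 * s + 2)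
  have hηc := hχ.hasCompactSupport_smul_pow hc (k := 2 * s + 2) (by omega)
  have i4 : Integrable fun x => -(χ (c • x) ^ (2 * s + 2) * (f x * lap f x)) -
      ∑ i, pd i (fun y => χ (c • y) ^ (2 * s + 2)) x * (f x * pd i f x) := by
    refine (hχ.integrable_mul hc (by omega) (hf.continuous.mul hlf.continuous)).neg.sub
      (integrable_finsetSum _ fun i _ => ?_)
    exact ((contDiff_pd i hη).continuous.mul (hf.continuous.mul (contDiff_pd i hf).continuous)
      ).integrable_of_hasCompactSupport (hηc.pd i).mul_right
  have hpt : ∀ x, c ^ 2 * (-(χ (c • x) ^ (2 * s + 2) * (f x * lap f x)) -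
      ∑ i, pd i (fun y => χ (c • y) ^ (2 * s + 2)) x * (f x * pd i f x)) ≤
      ε / 2 * (χ (c • x) ^ (2 * s + 4) * lap f x ^ 2) +
      (1 / ε + n * D ^ 2) / 2 * (c ^ 4 * (χ (c • x) ^ (2 * s) * f x ^ 2)) +
      1 / 2 * (c ^ 2 * (χ (c • x) ^ (2 * s + 2) * ∑ i, pd i f x ^ 2)) := by
    intro x
    have hD' := hD c hc
    set w := χ (c • x)
    have hw : 0 ≤ w := hχ.nonneg _
    have t1 : c ^ 2 * -(w ^ (2 * s + 2) * (f x * lap f x)) ≤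
        ε / 2 * (w ^ (2 * s + 4) * lap f x ^ 2) +
        1 / ε / 2 * (c ^ 4 * (w ^ (2 * s) * f x ^ 2)) := by
      have : 0 ≤ w ^ (2 * s) * (1 / (2 * ε)) * (ε * w ^ 2 * lap f x + c ^ 2 * f x) ^ 2 := by
        positivity
      have e : w ^ (2 * s) * (1 / (2 * ε)) * (ε * w ^ 2 * lap f x + c ^ 2 * f x) ^ 2 =
        ε / 2 * (w ^ (2 * s + 4) * lap f x ^ 2) +
        1 / ε / 2 * (c ^ 4 * (w ^ (2 * s) * f x ^ 2)) +
          c ^ 2 * (w ^ (2 * s + 2) * (f x * lap f x)) := by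
        field_simp
        ring
      linarith
    have t2 : ∀ i, c ^ 2 * -(pd i (fun y => χ (c • y) ^ (2 * s + 2)) x * (f x * pd i f x)) ≤
        D ^ 2 / 2 * (c ^ 4 * (w ^ (2 * s) * f x ^ 2)) +
          1 / 2 * (c ^ 2 * (w ^ (2 * s + 2) * pd i f x ^ 2)) := by
      intro i
      have h := hD' i x
      have h' : -(pd i (fun y => χ (c • y) ^ (2 * s + 2)) x * (f x * pd i f x)) ≤
          D * (c * w ^ (2 * s + 1)) * |f x * pd i f x| := by
        refine (neg_le_abs _).trans ?_
        rw [abs_mul]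
        exact mul_le_mul_of_nonneg_right h (abs_nonneg _)
      have h2 := mul_le_mul_of_nonneg_left h' (sq_nonneg c)
      have : 0 ≤ 1 / 2 * c ^ 2 * w ^ (2 * s) * (D * c * |f x| - w * |pd i f x|) ^ 2 := by
        positivity
      have e : 1 / 2 * c ^ 2 * w ^ (2 * s) * (D * c * |f x| - w * |pd i f x|) ^ 2 =
          D ^ 2 / 2 * (c ^ 4 * (w ^ (2 * s) * f x ^ 2)) +
          1 / 2 * (c ^ 2 * (w ^ (2 * s + 2) * pd i f x ^ 2)) -
          c ^ 2 * (D * (c * w ^ (2 * s + 1)) * |f x * pd i f x|) := by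
        rw [abs_mul, ← sq_abs (f x), ← sq_abs (pd i f x)]
        ring
      linarith
    have t3 := Finset.sum_le_sum fun i (_ : i ∈ Finset.univ) => t2 i
    rw [Finset.sum_add_distrib, ← Finset.mul_sum, Finset.sum_neg_distrib, Finset.sum_const,
      Finset.card_univ, Fintype.card_fin, nsmul_eq_mul, ← Finset.mul_sum, ← Finset.mul_sum,
      ← Finset.mul_sum] at t3
    linarith
  have hI := integral_le_of_le_linear_comb (i4.const_mul (c ^ 2)) i2 (i3.const_mul (c ^ 4))
    (i1.const_mul (c ^ 2)) hpt
  rw [integral_const_mul, ← integral_weight_mul_sum_pd_sq hη hηc hf] at hI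
  simp only [integral_const_mul] at hI
  linarith

end Interpolation

/-- The weighted quadratic form in the derivatives of `u` of order at most three. -/
noncomputable def lowerOrder {n : ℕ} (χ : EuclideanSpace ℝ (Fin n) → ℝ) (k : ℕ) (c : ℝ)
    (u : EuclideanSpace ℝ (Fin n) → ℝ) (x : EuclideanSpace ℝ (Fin n)) : ℝ :=
  c ^ 8 * (χ (c • x) ^ (2 * k) * u x ^ 2) +
    c ^ 6 * (χ (c • x) ^ (2 * k + 2) * ∑ i, pd i u x ^ 2) +
    c ^ 4 * (χ (c • x) ^ (2 * k + 4) * ∑ i, ∑ j, pd j (pd i u) x ^ 2) +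
    c ^ 2 * (χ (c • x) ^ (2 * k + 6) * ∑ i, pd i (lap u) x ^ 2)

section LowerOrder

variable {n : ℕ} {χ : EuclideanSpace ℝ (Fin n) → ℝ}

lemma sq_lap_le {u : EuclideanSpace ℝ (Fin n) → ℝ} (hu : ContDiff ℝ (⊤ : ℕ∞) u)
    (x : EuclideanSpace ℝ (Fin n)) :
    lap u x ^ 2 ≤ n * ∑ i, ∑ j, pd j (pd i u) x ^ 2 := by
  rw [lap_eq hu]
  have h := sq_sum_le_card_mul_sum_sq (s := Finset.univ) (f := fun i => pd i (pd i u) x)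
  rw [Finset.card_univ, Fintype.card_fin] at h
  refine h.trans (mul_le_mul_of_nonneg_left (Finset.sum_le_sum fun i _ => ?_) (by positivity))
  exact Finset.single_le_sum (f := fun j => pd j (pd i u) x ^ 2) (fun _ _ => sq_nonneg _)
    (Finset.mem_univ i)

/-- A chain of interpolation inequalities bounds intermediate quantities by the extreme ones. -/
lemma exists_interpolation_chain {X : Type*} (N : ℝ) (hN : 0 ≤ N) (a₀ a₁ a₂ a₃ a₄ : X → ℝ)
    (h₂ : ∀ x, 0 ≤ a₂ x) (h₃ : ∀ x, 0 ≤ a₃ x)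
    (h₄ : ∀ x, 0 ≤ a₄ x)
    (I₁ : ∀ ε > 0, ∃ C, 0 ≤ C ∧ ∀ x, a₁ x ≤ ε * a₂ x + C * a₀ x)
    (I₂ : ∀ ε > 0, ∃ C, 0 ≤ C ∧ ∀ x, a₂ x ≤ ε * a₃ x + C * a₁ x)
    (I₃ : ∀ ε > 0, ∃ C, 0 ≤ C ∧ ∀ x, a₃ x ≤ ε * a₄ x + C * (N * a₂ x)) {ε : ℝ} (hε : 0 < ε) :
    ∃ C, 0 ≤ C ∧ ∀ x, a₀ x + a₁ x + a₂ x + a₃ x ≤ ε * a₄ x + C * a₀ x := by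
  obtain ⟨C₃, hC₃, H₃⟩ := I₃ (ε / 10) (by positivity)
  obtain ⟨C₂, hC₂, H₂⟩ := I₂ (1 / (4 * (C₃ * N + 1))) (by positivity)
  obtain ⟨C₁, hC₁, H₁⟩ := I₁ (1 / (2 * (C₂ + 1))) (by positivity)
  have b₂ : ∀ x, a₂ x ≤ 2 * (1 / (4 * (C₃ * N + 1))) * a₃ x + 2 * C₂ * C₁ * a₀ x := by
    intro x
    have e : C₂ * (1 / (2 * (C₂ + 1))) ≤ 1 / 2 := by
      rw [mul_one_div, div_le_div_iff₀ (by positivity) (by positivity)]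
      linarith
    have := mul_le_mul_of_nonneg_left (H₁ x) hC₂
    have := mul_le_mul_of_nonneg_right e (h₂ x)
    have := H₂ x
    linarith
  have b₃ : ∀ x, a₃ x ≤ ε / 5 * a₄ x + 4 * C₃ * N * C₂ * C₁ * a₀ x := by
    intro x
    have e : C₃ * N * (2 * (1 / (4 * (C₃ * N + 1)))) ≤ 1 / 2 := by
      rw [mul_one_div, mul_div_assoc', div_le_div_iff₀ (by positivity) (by positivity)]
      linarith
    have := mul_le_mul_of_nonneg_left (b₂ x) (mul_nonneg hC₃ hN)
    have := mul_le_mul_of_nonneg_right e (h₃ x)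
    have := H₃ x
    linarith
  refine ⟨1 + C₁ + 2 * (2 * C₂ * C₁) + 3 * (4 * C₃ * N * C₂ * C₁), by positivity, fun x => ?_⟩
  have e₂ : 2 * (1 / (4 * (C₃ * N + 1))) ≤ 1 := by
    rw [mul_one_div, div_le_one (by positivity)]
    have := mul_nonneg hC₃ hN
    linarith
  have e₁ : 1 / (2 * (C₂ + 1)) ≤ 1 := by
    rw [div_le_one (by positivity)]
    linarith
  have := mul_le_mul_of_nonneg_right e₂ (h₃ x)
  have := mul_le_mul_of_nonneg_right e₁ (h₂ x)
  have := mul_nonneg hε.le (h₄ x)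
  have := b₂ x
  have := b₃ x
  have := H₁ x
  linarith

lemma IsCutoff.integrable_lowerOrder (hχ : IsCutoff χ) {k : ℕ} (hk : 1 ≤ k) {c : ℝ} (hc : 0 < c)
    {u : EuclideanSpace ℝ (Fin n) → ℝ} (hu : ContDiff ℝ (⊤ : ℕ∞) u) :
    Integrable (lowerOrder χ k c u) ∧ ∫ x, lowerOrder χ k c u x =
      c ^ 8 * (∫ x, χ (c • x) ^ (2 * k) * u x ^ 2) +
      c ^ 6 * (∫ x, χ (c • x) ^ (2 * k + 2) * ∑ i, pd i u x ^ 2) +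
      c ^ 4 * (∫ x, χ (c • x) ^ (2 * k + 4) * ∑ i, ∑ j, pd j (pd i u) x ^ 2) +
      c ^ 2 * (∫ x, χ (c • x) ^ (2 * k + 6) * ∑ i, pd i (lap u) x ^ 2) := by
  have i₀ : Integrable fun x => c ^ 8 * (χ (c • x) ^ (2 * k) * u x ^ 2) :=
    (hχ.integrable_mul hc (by omega) (hu.continuous.pow 2)).const_mul _
  have i₁ : Integrable fun x => c ^ 6 * (χ (c • x) ^ (2 * k + 2) * ∑ i, pd i u x ^ 2) :=
    (hχ.integrable_mul hc (by omega)
      (continuous_finsetSum _ fun i _ => (contDiff_pd i hu).continuous.pow 2)).const_mul _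
  have i₂ : Integrable fun x =>
      c ^ 4 * (χ (c • x) ^ (2 * k + 4) * ∑ i, ∑ j, pd j (pd i u) x ^ 2) :=
    (hχ.integrable_mul hc (by omega) (continuous_finsetSum _ fun i _ =>
      continuous_finsetSum _ fun j _ =>
        (contDiff_pd j (contDiff_pd i hu)).continuous.pow 2)).const_mul _
  have i₃ : Integrable fun x => c ^ 2 * (χ (c • x) ^ (2 * k + 6) * ∑ i, pd i (lap u) x ^ 2) :=
    (hχ.integrable_mul hc (by omega) (continuous_finsetSum _ fun i _ =>
      (contDiff_pd i (contDiff_lap hu)).continuous.pow 2)).const_mul _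
  refine ⟨((i₀.add i₁).add i₂).add i₃, ?_⟩
  simp only [← integral_const_mul]
  rw [← integral_add' i₀ i₁, ← integral_add' (i₀.add i₁) i₂,
    ← integral_add' ((i₀.add i₁).add i₂) i₃]
  rfl

lemma IsCutoff.sum_integral_mul {ι : Type*} [Fintype ι] (hχ : IsCutoff χ) {c : ℝ} (hc : 0 < c)
    {k : ℕ} (hk : 1 ≤ k) {h : ι → EuclideanSpace ℝ (Fin n) → ℝ} (hh : ∀ i, Continuous (h i)) :
    ∑ i, ∫ x, χ (c • x) ^ k * h i x = ∫ x, χ (c • x) ^ k * ∑ i, h i x := by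
  simp only [Finset.mul_sum]
  rw [integral_finsetSum _ fun i _ => hχ.integrable_mul hc hk (hh i)]

/-- The lower order terms are controlled by the top order term and the zeroth order term. -/
lemma IsCutoff.integral_lowerOrder_le (hχ : IsCutoff χ) {k : ℕ} (hk : 1 ≤ k) {ε : ℝ}
    (hε : 0 < ε) :
    ∃ C, 0 ≤ C ∧ ∀ c : ℝ, 0 < c → ∀ u : EuclideanSpace ℝ (Fin n) → ℝ, ContDiff ℝ (⊤ : ℕ∞) u →
      ∫ x, lowerOrder χ k c u x ≤ ε * (∫ x, χ (c • x) ^ (2 * k + 8) * lap (lap u) x ^ 2) +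
        C * (c ^ 8 * ∫ x, χ (c • x) ^ (2 * k) * u x ^ 2) := by
  have hw : ∀ (c : ℝ) x j, 0 ≤ χ (c • x) ^ j := fun c x j => pow_nonneg (hχ.nonneg _) j
  have hlap : ∀ c : ℝ, 0 < c → ∀ u : EuclideanSpace ℝ (Fin n) → ℝ, ContDiff ℝ (⊤ : ℕ∞) u →
      c ^ 4 * (∫ x, χ (c • x) ^ (2 * k + 4) * lap u x ^ 2) ≤
        n * (c ^ 4 * ∫ x, χ (c • x) ^ (2 * k + 4) * ∑ i, ∑ j, pd j (pd i u) x ^ 2) := by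
    intro c hc u hu
    rw [mul_left_comm, ← integral_const_mul (n : ℝ)]
    refine mul_le_mul_of_nonneg_left (integral_mono ?_ ?_ fun x => ?_) (by positivity)
    · exact hχ.integrable_mul hc (by omega) ((contDiff_lap hu).continuous.pow 2)
    · exact (hχ.integrable_mul hc (by omega) (continuous_finsetSum Finset.univ fun i _ =>
        continuous_finsetSum Finset.univ fun j _ =>
          (contDiff_pd j (contDiff_pd i hu)).continuous.pow 2)).const_mul _
    · dsimp only
      rw [mul_left_comm]
      exact mul_le_mul_of_nonneg_left (sq_lap_le hu x) (hw _ _ _)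
  have main := exists_interpolation_chain
    (X := {q : ℝ × (EuclideanSpace ℝ (Fin n) → ℝ) // 0 < q.1 ∧ ContDiff ℝ (⊤ : ℕ∞) q.2})
    n (by positivity)
    (fun q => q.1.1 ^ 8 * ∫ x, χ (q.1.1 • x) ^ (2 * k) * q.1.2 x ^ 2)
    (fun q => q.1.1 ^ 6 * ∫ x, χ (q.1.1 • x) ^ (2 * k + 2) * ∑ i, pd i q.1.2 x ^ 2)
    (fun q => q.1.1 ^ 4 * ∫ x, χ (q.1.1 • x) ^ (2 * k + 4) *
      ∑ i, ∑ j, pd j (pd i q.1.2) x ^ 2)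
    (fun q => q.1.1 ^ 2 * ∫ x, χ (q.1.1 • x) ^ (2 * k + 6) * ∑ i, pd i (lap q.1.2) x ^ 2)
    (fun q => ∫ x, χ (q.1.1 • x) ^ (2 * k + 8) * lap (lap q.1.2) x ^ 2)
    (fun q => mul_nonneg (pow_nonneg q.2.1.le 4) (integral_nonneg fun x =>
      mul_nonneg (hw _ _ _) (Finset.sum_nonneg fun i _ => Finset.sum_nonneg fun j _ =>
        sq_nonneg _)))
    (fun q => mul_nonneg (pow_nonneg q.2.1.le 2) (integral_nonneg fun x =>
      mul_nonneg (hw _ _ _) (Finset.sum_nonneg fun i _ => sq_nonneg _)))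
    (fun q => integral_nonneg fun x => mul_nonneg (hw _ _ _) (sq_nonneg _))
  specialize main (by
    intro ε hε
    obtain ⟨C, hC, h⟩ := hχ.interpolation (s := k) hk (ε := ε / (n + 1)) (by positivity)
    refine ⟨C, hC, ?_⟩
    rintro ⟨⟨c, u⟩, hc, hu⟩
    dsimp only at hc hu ⊢
    have h' := mul_le_mul_of_nonneg_left (h c hc u hu) (pow_nonneg hc.le 4)
    have h2 := mul_le_mul_of_nonneg_left (hlap c hc u hu) (show 0 ≤ ε / (n + 1) by positivity)
    have h3 : 0 ≤ c ^ 4 * ∫ x, χ (c • x) ^ (2 * k + 4) * ∑ i, ∑ j, pd j (pd i u) x ^ 2 :=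
      mul_nonneg (by positivity) (integral_nonneg fun x => mul_nonneg (hw _ _ _)
        (Finset.sum_nonneg fun i _ => Finset.sum_nonneg fun j _ => sq_nonneg _))
    have h4 : ε / (n + 1) * n ≤ ε := by
      rw [div_mul_eq_mul_div, div_le_iff₀ (by positivity)]
      linarith
    have h5 := mul_le_mul_of_nonneg_right h4 h3
    linarith)
  specialize main (by
    intro ε hε
    obtain ⟨C, hC, h⟩ := hχ.interpolation (s := k + 1) (by omega) hε
    refine ⟨C, hC, ?_⟩
    rintro ⟨⟨c, u⟩, hc, hu⟩
    dsimp only at hc hu ⊢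
    have h' := Finset.sum_le_sum fun i (_ : i ∈ Finset.univ) =>
      mul_le_mul_of_nonneg_left (h c hc (pd i u) (contDiff_pd i hu)) (sq_nonneg c)
    have s₁ := hχ.sum_integral_mul hc (k := 2 * k + 4) (by omega)
      (h := fun i x => ∑ j, pd j (pd i u) x ^ 2) fun i =>
        continuous_finsetSum _ fun j _ => (contDiff_pd j (contDiff_pd i hu)).continuous.pow 2
    have s₂ := hχ.sum_integral_mul hc (k := 2 * k + 6) (by omega)
      (h := fun i x => lap (pd i u) x ^ 2) fun i =>
        (contDiff_lap (contDiff_pd i hu)).continuous.pow 2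
    have s₃ := hχ.sum_integral_mul hc (k := 2 * k + 2) (by omega)
      (h := fun i x => pd i u x ^ 2) fun i => (contDiff_pd i hu).continuous.pow 2
    rw [← Finset.mul_sum, ← Finset.mul_sum, ← Finset.mul_sum, Finset.sum_add_distrib,
      ← Finset.mul_sum, ← Finset.mul_sum, ← Finset.mul_sum,
      show 2 * (k + 1) + 2 = 2 * k + 4 by ring, show 2 * (k + 1) + 4 = 2 * k + 6 by ring,
      show 2 * (k + 1) = 2 * k + 2 by ring, s₁, s₂, s₃] at h'
    simp only [← pd_lap _ hu] at h'
    linarith)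
  obtain ⟨C, hC, H⟩ := main (by
    intro ε hε
    obtain ⟨C, hC, h⟩ := hχ.interpolation (s := k + 2) (by omega) hε
    refine ⟨C, hC, ?_⟩
    rintro ⟨⟨c, u⟩, hc, hu⟩
    dsimp only at hc hu ⊢
    have h' := h c hc (lap u) (contDiff_lap hu)
    have h2 := mul_le_mul_of_nonneg_left (hlap c hc u hu) hC
    rw [show 2 * (k + 2) + 2 = 2 * k + 6 by ring, show 2 * (k + 2) + 4 = 2 * k + 8 by ring,
      show 2 * (k + 2) = 2 * k + 4 by ring] at h'
    linarith) hε
  refine ⟨C, hC, fun c hc u hu => ?_⟩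
  rw [(hχ.integrable_lowerOrder hk hc hu).2]
  exact H ⟨(c, u), hc, hu⟩

end LowerOrder
section Commutator

variable {n : ℕ} {χ : EuclideanSpace ℝ (Fin n) → ℝ}

lemma sq_sum_mul_le {ι : Type*} [Fintype ι] {a b : ι → ℝ} {M : ℝ} (h : ∀ i, |a i| ≤ M) :
    (∑ i, a i * b i) ^ 2 ≤ Fintype.card ι * M ^ 2 * ∑ i, b i ^ 2 := by
  refine (Finset.sum_mul_sq_le_sq_mul_sq _ a b).trans
    (mul_le_mul_of_nonneg_right ?_ (Finset.sum_nonneg fun i _ => sq_nonneg _))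
  refine (Finset.sum_le_card_nsmul _ _ (M ^ 2) fun i _ => ?_).trans ?_
  · exact sq_le_sq' (abs_le.1 (h i)).1 (abs_le.1 (h i)).2
  · rw [nsmul_eq_mul, Finset.card_univ]

lemma abs_mul_le_of_sq_le {L R P Q ε : ℝ} (hε : 0 < ε) (hP : 0 ≤ P) (hQ : 0 ≤ Q)
    (h : R ^ 2 ≤ P * Q) : |L * R| ≤ ε / 2 * (P * L ^ 2) + 1 / (2 * ε) * Q := by
  refine abs_le_of_sq_le_sq ?_ (by positivity)
  have h1 := mul_le_mul_of_nonneg_left h (sq_nonneg L)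
  have h2 := four_mul_le_sq_add (ε / 2 * (P * L ^ 2)) (1 / (2 * ε) * Q)
  have e : 4 * (ε / 2 * (P * L ^ 2)) * (1 / (2 * ε) * Q) = L ^ 2 * (P * Q) := by
    field_simp
    ring
  rw [mul_pow]
  linarith

lemma IsCutoff.lowerOrder_nonneg (hχ : IsCutoff χ) (k : ℕ) {c : ℝ} (hc : 0 < c)
    (u : EuclideanSpace ℝ (Fin n) → ℝ) (x : EuclideanSpace ℝ (Fin n)) :
    0 ≤ lowerOrder χ k c u x := by
  have := hχ.nonneg (c • x)
  unfold lowerOrder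
  positivity

/-- The commutator of the bilaplacian with a power of a cutoff is of lower order. -/
lemma IsCutoff.sq_commutator_le (hχ : IsCutoff χ) {k : ℕ} (hk : 1 ≤ k) (j : ℕ) :
    ∃ C, 0 ≤ C ∧ ∀ c : ℝ, 0 < c → ∀ u : EuclideanSpace ℝ (Fin n) → ℝ, ContDiff ℝ (⊤ : ℕ∞) u →
      ∀ x, (lap (lap (fun y => χ (c • y) ^ (j + k + 4) * u y)) x -
        χ (c • x) ^ (j + k + 4) * lap (lap u) x) ^ 2 ≤
          χ (c • x) ^ (2 * j) * (C * lowerOrder χ k c u x) := by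
  obtain ⟨D, hD, H⟩ := PowDvd.exists_bounds hχ (k := j + k) (by omega) (powDvd_pow (j + k + 4))
  refine ⟨5 * (16 * D ^ 2 * (n + 1) ^ 2 * 2), by positivity, fun c hc u hu x => ?_⟩
  obtain ⟨h₁, h₂, h₃, h₄, h₅⟩ := H c hc x
  rw [lap_lap_mul (hχ.contDiff_smul_pow c (j + k + 4)) hu, add_sub_cancel_left]
  set f := fun y => χ (c • y) ^ (j + k + 4)
  have hw := hχ.nonneg (c • x)
  set w := χ (c • x) with hwdef
  have b₁ := sq_sum_mul_le (b := fun i => pd i (lap u) x) h₁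
  have b₂ := sq_sum_mul_le (a := fun q : Fin n × Fin n => pd q.2 (pd q.1 f) x)
    (b := fun q => pd q.2 (pd q.1 u) x) fun q => h₂ q.1 q.2
  have b₄ := sq_sum_mul_le (b := fun i => pd i u x) h₄
  rw [Fintype.sum_prod_type, Fintype.sum_prod_type, Fintype.card_prod, Fintype.card_fin,
    Nat.cast_mul] at b₂
  rw [Fintype.card_fin] at b₁ b₄
  have b₃ : (lap f x * lap u x) ^ 2 ≤ (D * (c ^ 2 * w ^ (j + k + 2))) ^ 2 *
      (n * ∑ i, ∑ j, pd j (pd i u) x ^ 2) := by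
    rw [mul_pow]
    exact mul_le_mul (sq_le_sq' (abs_le.1 h₃).1 (abs_le.1 h₃).2) (sq_lap_le hu x)
      (sq_nonneg _) (sq_nonneg _)
  have b₅ : (lap (lap f) x * u x) ^ 2 ≤ (D * (c ^ 4 * w ^ (j + k))) ^ 2 * u x ^ 2 := by
    rw [mul_pow]
    exact mul_le_mul_of_nonneg_right (sq_le_sq' (abs_le.1 h₅).1 (abs_le.1 h₅).2) (sq_nonneg _)
  have s₁ : 0 ≤ ∑ i, pd i u x ^ 2 := Finset.sum_nonneg fun i _ => sq_nonneg _
  have s₂ : 0 ≤ ∑ i, ∑ j, pd j (pd i u) x ^ 2 :=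
    Finset.sum_nonneg fun i _ => Finset.sum_nonneg fun j _ => sq_nonneg _
  have s₃ : 0 ≤ ∑ i, pd i (lap u) x ^ 2 := Finset.sum_nonneg fun i _ => sq_nonneg _
  have hn : (0 : ℝ) ≤ n := Nat.cast_nonneg n
  have hlow : lowerOrder χ k c u x = c ^ 8 * (w ^ (2 * k) * u x ^ 2) +
    c ^ 6 * (w ^ (2 * k + 2) * ∑ i, pd i u x ^ 2) +
    c ^ 4 * (w ^ (2 * k + 4) * ∑ i, ∑ j, pd j (pd i u) x ^ 2) +
    c ^ 2 * (w ^ (2 * k + 6) * ∑ i, pd i (lap u) x ^ 2) := rfl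
  rw [hlow]
  dsimp only at b₁ b₂ b₄
  generalize (∑ i, pd i f x * pd i (lap u) x) = T₁ at *
  generalize (∑ i, ∑ j, pd j (pd i f) x * pd j (pd i u) x) = T₂ at *
  generalize (lap f x) = F₃ at *
  generalize (∑ i, pd i (lap f) x * pd i u x) = T₄ at *
  generalize (lap (lap f) x) = F₅ at *
  generalize (∑ i, pd i u x ^ 2) = S₁ at *
  generalize (∑ i, ∑ j, pd j (pd i u) x ^ 2) = S₂ at *
  generalize (∑ i, pd i (lap u) x ^ 2) = S₃ at *
  have five : ∀ a b c d e : ℝ, (a + b + c + d + e) ^ 2 ≤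
      5 * (a ^ 2 + b ^ 2 + c ^ 2 + d ^ 2 + e ^ 2) := fun a b c d e => by
    linarith [sq_nonneg (a - b), sq_nonneg (a - c), sq_nonneg (a - d), sq_nonneg (a - e),
      sq_nonneg (b - c), sq_nonneg (b - d), sq_nonneg (b - e), sq_nonneg (c - d),
      sq_nonneg (c - e), sq_nonneg (d - e)]
  refine (five _ _ _ _ _).trans ?_
  set K := w ^ (2 * j) * (16 * D ^ 2) with hK
  have hK0 : 0 ≤ K := by positivity
  have key : ∀ (a Q : ℝ), 0 ≤ Q → a ≤ (n + 1) ^ 2 → K * a * Q ≤ K * (n + 1) ^ 2 * Q :=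
    fun a Q hQ ha => mul_le_mul_of_nonneg_right (mul_le_mul_of_nonneg_left ha hK0) hQ
  have n₁ : (n : ℝ) ≤ (n + 1) ^ 2 := by nlinarith
  have n₂ : (n : ℝ) * n ≤ (n + 1) ^ 2 := by nlinarith
  have k₁ := key n (c ^ 2 * (w ^ (2 * k + 6) * S₃)) (by positivity) n₁
  have k₂ := key (n * n) (c ^ 4 * (w ^ (2 * k + 4) * S₂)) (by positivity) n₂
  have k₃ := key (n / 4) (c ^ 4 * (w ^ (2 * k + 4) * S₂)) (by positivity) (by linarith)
  have k₄ := key n (c ^ 6 * (w ^ (2 * k + 2) * S₁)) (by positivity) n₁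
  have k₅ := key (1 / 16) (c ^ 8 * (w ^ (2 * k) * u x ^ 2)) (by positivity) (by nlinarith)
  have z₀ : 0 ≤ K * (n + 1) ^ 2 * (c ^ 8 * (w ^ (2 * k) * u x ^ 2)) := by positivity
  have z₁ : 0 ≤ K * (n + 1) ^ 2 * (c ^ 6 * (w ^ (2 * k + 2) * S₁)) := by positivity
  have z₃ : 0 ≤ K * (n + 1) ^ 2 * (c ^ 2 * (w ^ (2 * k + 6) * S₃)) := by positivity
  have e₁ : (4 * T₁) ^ 2 ≤ K * n * (c ^ 2 * (w ^ (2 * k + 6) * S₃)) := by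
    refine le_trans (le_of_eq (by ring)) ((mul_le_mul_of_nonneg_left b₁
      (by norm_num : (0 : ℝ) ≤ 16)).trans (le_of_eq ?_))
    rw [hK]
    ring
  have e₂ : (4 * T₂) ^ 2 ≤ K * (n * n) * (c ^ 4 * (w ^ (2 * k + 4) * S₂)) := by
    refine le_trans (le_of_eq (by ring)) ((mul_le_mul_of_nonneg_left b₂
      (by norm_num : (0 : ℝ) ≤ 16)).trans (le_of_eq ?_))
    rw [hK]
    ring
  have e₃ : (2 * F₃ * lap u x) ^ 2 ≤ K * (n / 4) * (c ^ 4 * (w ^ (2 * k + 4) * S₂)) := by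
    refine le_trans (le_of_eq (by ring)) ((mul_le_mul_of_nonneg_left b₃
      (by norm_num : (0 : ℝ) ≤ 4)).trans (le_of_eq ?_))
    rw [hK]
    ring
  have e₄ : (4 * T₄) ^ 2 ≤ K * n * (c ^ 6 * (w ^ (2 * k + 2) * S₁)) := by
    refine le_trans (le_of_eq (by ring)) ((mul_le_mul_of_nonneg_left b₄
      (by norm_num : (0 : ℝ) ≤ 16)).trans (le_of_eq ?_))
    rw [hK]
    ring
  have e₅ : (F₅ * u x) ^ 2 ≤ K * (1 / 16) * (c ^ 8 * (w ^ (2 * k) * u x ^ 2)) := by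
    refine b₅.trans (le_of_eq ?_)
    rw [hK]
    ring
  have split : w ^ (2 * j) * (5 * (16 * D ^ 2 * (n + 1) ^ 2 * 2) *
      (c ^ 8 * (w ^ (2 * k) * u x ^ 2) + c ^ 6 * (w ^ (2 * k + 2) * S₁) +
        c ^ 4 * (w ^ (2 * k + 4) * S₂) + c ^ 2 * (w ^ (2 * k + 6) * S₃))) =
      10 * (K * (n + 1) ^ 2 * (c ^ 8 * (w ^ (2 * k) * u x ^ 2)) +
        K * (n + 1) ^ 2 * (c ^ 6 * (w ^ (2 * k + 2) * S₁)) +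
        K * (n + 1) ^ 2 * (c ^ 4 * (w ^ (2 * k + 4) * S₂)) +
        K * (n + 1) ^ 2 * (c ^ 2 * (w ^ (2 * k + 6) * S₃))) := by
    rw [hK]
    ring
  rw [split]
  linarith

/-- The energy identity obtained by testing against a cutoff multiple of the function. -/
lemma IsCutoff.abs_energy_sub_le (hχ : IsCutoff χ) {k : ℕ} (hk : 1 ≤ k) {ε : ℝ} (hε : 0 < ε) :
    ∃ C, 0 ≤ C ∧ ∀ c : ℝ, 0 < c → ∀ u : EuclideanSpace ℝ (Fin n) → ℝ, ContDiff ℝ (⊤ : ℕ∞) u →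
      |(∫ x, χ (c • x) ^ (2 * k + 8) * lap (lap u) x ^ 2) -
        ∫ x, χ (c • x) ^ (2 * k + 8) * (lap (lap (lap (lap u))) x * u x)| ≤
      ε * (∫ x, χ (c • x) ^ (2 * k + 8) * lap (lap u) x ^ 2) +
        C * (c ^ 8 * ∫ x, χ (c • x) ^ (2 * k) * u x ^ 2) := by
  obtain ⟨C, hC, H⟩ := hχ.sq_commutator_le hk (k + 4)
  obtain ⟨B, hB, H'⟩ := hχ.integral_lowerOrder_le hk (ε := ε ^ 2 / (C + 1)) (by positivity)
  refine ⟨1 / (2 * ε) * (C * B), by positivity, fun c hc u hu => ?_⟩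
  have hL := contDiff_lap (contDiff_lap hu)
  have hw := hχ.contDiff_smul_pow c (2 * k + 8)
  have hwc := hχ.hasCompactSupport_smul_pow hc (k := 2 * k + 8) (by omega)
  have hwu : ContDiff ℝ (⊤ : ℕ∞) fun x => χ (c • x) ^ (2 * k + 8) * u x := hw.mul hu
  have hwuc : HasCompactSupport fun x => χ (c • x) ^ (2 * k + 8) * u x := hwc.mul_right
  have i₁ : Integrable fun x => χ (c • x) ^ (2 * k + 8) * lap (lap u) x ^ 2 :=
    hχ.integrable_mul hc (by omega) (hL.continuous.pow 2)
  have i₂ : Integrable fun x =>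
      lap (lap u) x * lap (lap fun x => χ (c • x) ^ (2 * k + 8) * u x) x :=
    (hL.continuous.mul (contDiff_lap (contDiff_lap hwu)).continuous
      ).integrable_of_hasCompactSupport
        ((hwuc.lap hwu).lap (contDiff_lap hwu)).mul_left
  have i₃ := (hχ.integrable_lowerOrder hk hc hu).1
  have e : ∫ x, χ (c • x) ^ (2 * k + 8) * (lap (lap (lap (lap u))) x * u x) =
      ∫ x, lap (lap u) x * lap (lap fun x => χ (c • x) ^ (2 * k + 8) * u x) x := by
    rw [← integral_lap_mul hL (contDiff_lap hwu) (hwuc.lap hwu),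
      ← integral_lap_mul (contDiff_lap hL) hwu hwuc]
    exact integral_congr_ae (.of_forall fun x => by ring)
  rw [e, ← integral_sub i₁ i₂]
  have hpt : ∀ x, |χ (c • x) ^ (2 * k + 8) * lap (lap u) x ^ 2 -
      lap (lap u) x * lap (lap fun x => χ (c • x) ^ (2 * k + 8) * u x) x| ≤
      ε / 2 * (χ (c • x) ^ (2 * k + 8) * lap (lap u) x ^ 2) +
        1 / (2 * ε) * C * lowerOrder χ k c u x + 0 * lowerOrder χ k c u x := by
    intro x
    have h := H c hc u hu x
    rw [show k + 4 + k + 4 = 2 * k + 8 by ring, show 2 * (k + 4) = 2 * k + 8 by ring] at h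
    have h2 := abs_mul_le_of_sq_le (L := lap (lap u) x) hε (pow_nonneg (hχ.nonneg _) _)
      (mul_nonneg hC (hχ.lowerOrder_nonneg k hc u x)) h
    rw [← abs_neg]
    refine le_trans (le_of_eq (congrArg _ (by ring))) (h2.trans (le_of_eq (by ring)))
  have hI := integral_le_of_le_linear_comb (i₁.sub i₂).abs i₁ i₃ i₃ hpt
  refine (abs_integral_le_integral_abs).trans (hI.trans ?_)
  have hA : 0 ≤ ∫ x, χ (c • x) ^ (2 * k + 8) * lap (lap u) x ^ 2 :=
    integral_nonneg fun x => mul_nonneg (pow_nonneg (hχ.nonneg _) _) (sq_nonneg _)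
  have h3 := mul_le_mul_of_nonneg_left (H' c hc u hu) (show 0 ≤ 1 / (2 * ε) * C by positivity)
  have h4 : 1 / (2 * ε) * C * (ε ^ 2 / (C + 1)) ≤ ε / 2 := by
    rw [show 1 / (2 * ε) * C * (ε ^ 2 / (C + 1)) = ε / 2 * (C / (C + 1)) by field_simp]
    exact mul_le_of_le_one_right (by positivity) ((div_le_one (by positivity)).2 (by linarith))
  have h5 := mul_le_mul_of_nonneg_right h4 hA
  linarith

/-- Multiplication by a cutoff almost does not increase the quadratic energy. -/
lemma IsCutoff.integral_sq_lap_lap_mul_le (hχ : IsCutoff χ) {k : ℕ} (hk : 1 ≤ k) {ε : ℝ}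
    (hε : 0 < ε) :
    ∃ C, 0 ≤ C ∧ ∀ c : ℝ, 0 < c → ∀ u : EuclideanSpace ℝ (Fin n) → ℝ, ContDiff ℝ (⊤ : ℕ∞) u →
      ∫ x, lap (lap fun y => χ (c • y) ^ (k + 4) * u y) x ^ 2 ≤
      (1 + ε) * (∫ x, χ (c • x) ^ (2 * k + 8) * lap (lap u) x ^ 2) +
        C * (c ^ 8 * ∫ x, χ (c • x) ^ (2 * k) * u x ^ 2) := by
  obtain ⟨C, hC, H⟩ := hχ.sq_commutator_le hk 0
  obtain ⟨B, hB, H'⟩ := hχ.integral_lowerOrder_le hk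
    (ε := ε / 2 / ((1 + 2 / ε) * C + 1)) (by positivity)
  refine ⟨(1 + 2 / ε) * C * B, by positivity, fun c hc u hu => ?_⟩
  have hL := contDiff_lap (contDiff_lap hu)
  have hw := hχ.contDiff_smul_pow c (k + 4)
  have hwc := hχ.hasCompactSupport_smul_pow hc (k := k + 4) (by omega)
  have hwu : ContDiff ℝ (⊤ : ℕ∞) fun x => χ (c • x) ^ (k + 4) * u x := hw.mul hu
  have hwuc : HasCompactSupport fun x => χ (c • x) ^ (k + 4) * u x := hwc.mul_right
  have i₁ : Integrable fun x => χ (c • x) ^ (2 * k + 8) * lap (lap u) x ^ 2 :=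
    hχ.integrable_mul hc (by omega) (hL.continuous.pow 2)
  have i₂ : Integrable fun x => lap (lap fun x => χ (c • x) ^ (k + 4) * u x) x ^ 2 := by
    simp only [sq]
    exact ((contDiff_lap (contDiff_lap hwu)).continuous.mul
      (contDiff_lap (contDiff_lap hwu)).continuous).integrable_of_hasCompactSupport
        ((hwuc.lap hwu).lap (contDiff_lap hwu)).mul_left
  have i₃ := (hχ.integrable_lowerOrder hk hc hu).1
  have hpt : ∀ x, lap (lap fun x => χ (c • x) ^ (k + 4) * u x) x ^ 2 ≤
      (1 + ε / 2) * (χ (c • x) ^ (2 * k + 8) * lap (lap u) x ^ 2) +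
        (1 + 2 / ε) * C * lowerOrder χ k c u x + 0 * lowerOrder χ k c u x := by
    intro x
    have h := H c hc u hu x
    rw [zero_add, mul_zero, pow_zero, one_mul] at h
    generalize lap (lap fun x => χ (c • x) ^ (k + 4) * u x) x = Y at *
    have hP : χ (c • x) ^ (2 * k + 8) * lap (lap u) x ^ 2 =
      (χ (c • x) ^ (k + 4) * lap (lap u) x) ^ 2 := by ring
    rw [hP]
    generalize χ (c • x) ^ (k + 4) * lap (lap u) x = Z at *
    have h2 := mul_le_mul_of_nonneg_left h (show 0 ≤ 1 + 2 / ε by positivity)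
    have h3 : 0 ≤ ε / 2 * (Z - 2 / ε * (Y - Z)) ^ 2 := by positivity
    have h4 : ε / 2 * (Z - 2 / ε * (Y - Z)) ^ 2 =
        (1 + ε / 2) * Z ^ 2 + (1 + 2 / ε) * (Y - Z) ^ 2 - Y ^ 2 := by
      field_simp
      ring
    linarith
  have hI := integral_le_of_le_linear_comb i₂ i₁ i₃ i₃ hpt
  refine hI.trans ?_
  have hA : 0 ≤ ∫ x, χ (c • x) ^ (2 * k + 8) * lap (lap u) x ^ 2 :=
    integral_nonneg fun x => mul_nonneg (pow_nonneg (hχ.nonneg _) _) (sq_nonneg _)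
  have h3 := mul_le_mul_of_nonneg_left (H' c hc u hu)
    (show 0 ≤ (1 + 2 / ε) * C by positivity)
  have h4 : (1 + 2 / ε) * C * (ε / 2 / ((1 + 2 / ε) * C + 1)) ≤ ε / 2 := by
    have : 0 ≤ (1 + 2 / ε) * C := by positivity
    rw [mul_div_assoc', div_le_iff₀ (by positivity)]
    nlinarith
  have h5 := mul_le_mul_of_nonneg_right h4 hA
  linarith

end Commutator
section Stability

variable {n : ℕ} {χ : EuclideanSpace ℝ (Fin n) → ℝ}

lemma HasCompactSupport.sq_fun {X : Type*} [TopologicalSpace X] {f : X → ℝ}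
    (h : HasCompactSupport f) : HasCompactSupport fun x => f x ^ 2 := by
  simp only [sq]
  exact h.mul_left

/-- Stability outside a compact set gives the stability inequality for cutoff multiples of a
given function, up to a constant independent of the cutoff radius. -/
lemma IsCutoff.exists_stability_bound (hχ : IsCutoff χ) (h₁ : ∀ x, ‖x‖ ≤ 1 → χ x = 1)
    (h₂ : ∀ x, 2 ≤ ‖x‖ → χ x = 0) {V u : EuclideanSpace ℝ (Fin n) → ℝ} (hV : Continuous V)
    (hu : ContDiff ℝ (⊤ : ℕ∞) u) {K : Set (EuclideanSpace ℝ (Fin n))} (hK : IsCompact K)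
    (hs : ∀ φ : EuclideanSpace ℝ (Fin n) → ℝ, ContDiff ℝ (⊤ : ℕ∞) φ → HasCompactSupport φ →
      tsupport φ ⊆ Kᶜ → ∫ x, V x * φ x ^ 2 ≤ ∫ x, lap (lap φ) x ^ 2) {m : ℕ} (hm : 1 ≤ m) :
    ∃ C, ∃ c₀ > 0, ∀ c : ℝ, 0 < c → c < c₀ →
      ∫ x, V x * (χ (c • x) ^ m * u x) ^ 2 ≤
        (∫ x, lap (lap fun y => χ (c • y) ^ m * u y) x ^ 2) + C := by
  obtain ⟨R, hR, hKR⟩ := hK.isBounded.exists_pos_norm_le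
  set ζ : EuclideanSpace ℝ (Fin n) → ℝ := fun x => 1 - χ ((1 / (2 * R)) • x) with hζdef
  have hζ : ContDiff ℝ (⊤ : ℕ∞) ζ := contDiff_const.sub (contDiff_comp_smul _ hχ.smooth)
  have hnorm : ∀ a : ℝ, 0 < a → ∀ x : EuclideanSpace ℝ (Fin n), ‖a • x‖ = a * ‖x‖ := fun a ha x => by
    rw [norm_smul, Real.norm_of_nonneg ha.le]
  have hζ0 : ∀ x, ‖x‖ ≤ 2 * R → ζ x = 0 := fun x hx => by
    rw [hζdef]
    dsimp only
    rw [h₁, sub_self]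
    rw [hnorm _ (by positivity), one_div_mul_eq_div, div_le_one (by positivity)]
    exact hx
  have hζ1 : ∀ x, 4 * R < ‖x‖ → ζ x = 1 := fun x hx => by
    rw [hζdef]
    dsimp only
    rw [h₂, sub_zero]
    rw [hnorm _ (by positivity), one_div_mul_eq_div, le_div_iff₀ (by positivity)]
    linarith
  have hζs : tsupport ζ ⊆ Kᶜ := by
    have : tsupport ζ ⊆ {x | 2 * R ≤ ‖x‖} := by
      refine closure_minimal (fun x hx => ?_) (isClosed_le continuous_const continuous_norm)
      by_contra hlt
      exact hx (hζ0 x (not_le.1 hlt).le)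
    intro x hx hxK
    have h := this hx
    have h' := hKR x hxK
    rw [Set.mem_ofPred_eq] at h
    linarith
  set q : (EuclideanSpace ℝ (Fin n) → ℝ) → EuclideanSpace ℝ (Fin n) → ℝ :=
    fun φ x => lap (lap φ) x ^ 2 - V x * φ x ^ 2 with hq
  have hqc : ∀ φ, ContDiff ℝ (⊤ : ℕ∞) φ → Continuous (q φ) := fun φ hφ =>
    ((contDiff_lap (contDiff_lap hφ)).continuous.pow 2).sub (hV.mul (hφ.continuous.pow 2))
  have hint : ∀ φ, ContDiff ℝ (⊤ : ℕ∞) φ → HasCompactSupport φ →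
      Integrable (fun x => lap (lap φ) x ^ 2) ∧ Integrable (fun x => V x * φ x ^ 2) := by
    intro φ hφ hφc
    refine ⟨?_, ?_⟩
    · exact ((contDiff_lap (contDiff_lap hφ)).continuous.pow 2).integrable_of_hasCompactSupport
        ((hφc.lap hφ).lap (contDiff_lap hφ)).sq_fun
    · exact (hV.mul (hφ.continuous.pow 2)).integrable_of_hasCompactSupport
        hφc.sq_fun.mul_left
  have hqi : ∀ φ, ContDiff ℝ (⊤ : ℕ∞) φ → HasCompactSupport φ → Integrable (q φ) ∧
      ∫ x, q φ x = (∫ x, lap (lap φ) x ^ 2) - ∫ x, V x * φ x ^ 2 := fun φ hφ hφc =>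
    ⟨(hint φ hφ hφc).1.sub (hint φ hφ hφc).2,
      integral_sub (hint φ hφ hφc).1 (hint φ hφ hφc).2⟩
  have hqcongr : ∀ {φ ψ : EuclideanSpace ℝ (Fin n) → ℝ} {x}, φ =ᶠ[nhds x] ψ → q φ x = q ψ x := by
    intro φ ψ x h
    simp only [hq, lap_lap_congr_nhds h, h.eq_of_nhds]
  set d : EuclideanSpace ℝ (Fin n) → ℝ := fun x => q u x - q (fun y => ζ y * u y) x with hd
  have hdi : Integrable ((Metric.closedBall 0 (4 * R)).indicator d) :=
    (((hqc u hu).sub (hqc _ (hζ.mul hu))).continuousOn.integrableOn_compact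
      (isCompact_closedBall _ _)).integrable_indicator Metric.isClosed_closedBall.measurableSet
  refine ⟨-∫ x, (Metric.closedBall 0 (4 * R)).indicator d x, 1 / (4 * R), by positivity,
    fun c hc hcR => ?_⟩
  set v : EuclideanSpace ℝ (Fin n) → ℝ := fun y => χ (c • y) ^ m * u y with hv
  have hvs : ContDiff ℝ (⊤ : ℕ∞) v := (hχ.contDiff_smul_pow c m).mul hu
  have hvc : HasCompactSupport v := (hχ.hasCompactSupport_smul_pow hc hm).mul_right
  have hζv : ContDiff ℝ (⊤ : ℕ∞) fun y => ζ y * v y := hζ.mul hvs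
  have hζvc : HasCompactSupport fun y => ζ y * v y := hvc.mul_left
  have hst := hs _ hζv hζvc ((tsupport_mul_subset_left (f := ζ) (g := v)).trans hζs)
  have hdecomp : ∀ x, q v x =
      q (fun y => ζ y * v y) x + (Metric.closedBall 0 (4 * R)).indicator d x := by
    intro x
    by_cases hx : ‖x‖ ≤ 4 * R
    · rw [Set.indicator_of_mem (mem_closedBall_zero_iff.2 hx)]
      have hvu : v =ᶠ[nhds x] u := by
        have : ∀ᶠ y in nhds x, ‖y‖ < 1 / c :=
          continuous_norm.continuousAt.eventually_lt continuousAt_const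
            (hx.trans_lt (by rwa [lt_div_comm₀ (by positivity) hc]))
        filter_upwards [this] with y hy
        rw [hv]
        dsimp only
        rw [h₁ (c • y), one_pow, one_mul]
        rw [hnorm c hc]
        rw [lt_div_iff₀ hc] at hy
        linarith
      have hζvu : (fun y => ζ y * v y) =ᶠ[nhds x] fun y => ζ y * u y := by
        filter_upwards [hvu] with y hy
        rw [hy]
      rw [hqcongr hvu, hqcongr hζvu, hd]
      ring
    · rw [Set.indicator_of_notMem (fun h => hx (mem_closedBall_zero_iff.1 h)), add_zero]
      refine hqcongr ?_
      have : ∀ᶠ y in nhds x, 4 * R < ‖y‖ :=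
        continuousAt_const.eventually_lt continuous_norm.continuousAt (not_le.1 hx)
      filter_upwards [this] with y hy
      rw [hζ1 y hy, one_mul]
  have hI : ∫ x, q v x = (∫ x, q (fun y => ζ y * v y) x) +
      ∫ x, (Metric.closedBall 0 (4 * R)).indicator d x := by
    rw [← integral_add (hqi _ hζv hζvc).1 hdi]
    exact integral_congr_ae (.of_forall hdecomp)
  rw [(hqi v hvs hvc).2, (hqi _ hζv hζvc).2] at hI
  linarith

end Stability

section Limits

variable {n : ℕ} {χ : EuclideanSpace ℝ (Fin n) → ℝ}

lemma integral_pow_mul_comp_smul {c : ℝ} (hc : 0 < c) :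
    ∫ x, c ^ n * χ (c • x) = ∫ x, χ x := by
  rw [integral_const_mul, Measure.integral_comp_smul, finrank_euclideanSpace_fin,
    abs_of_pos (by positivity), smul_eq_mul, mul_inv_cancel_left₀ (by positivity)]

/-- A nonnegative continuous function with bounded cutoff integrals is integrable. -/
lemma IsCutoff.integrable_of_bound (hχ : IsCutoff χ) (h₁ : ∀ x, ‖x‖ ≤ 1 → χ x = 1)
    {F : EuclideanSpace ℝ (Fin n) → ℝ} (hF : Continuous F) (hF0 : ∀ x, 0 ≤ F x) {k : ℕ}
    (hk : 1 ≤ k) {B c₀ : ℝ} (hc₀ : 0 < c₀)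
    (h : ∀ c : ℝ, 0 < c → c < c₀ → ∫ x, χ (c • x) ^ k * F x ≤ B) : Integrable F := by
  refine (aecover_closedBall (μ := volume) (x := (0 : EuclideanSpace ℝ (Fin n)))
    (r := fun r : ℝ => r) Filter.tendsto_id).integrable_of_integral_norm_bounded B
    (fun r => hF.continuousOn.integrableOn_compact (isCompact_closedBall _ _)) ?_
  filter_upwards [Filter.eventually_gt_atTop (1 / c₀)] with r hr
  have hr0 : 0 < r := lt_trans (by positivity) hr
  have hc : 0 < 1 / r := by positivity
  refine le_trans ?_ (h (1 / r) hc ((one_div_lt hr0 hc₀).2 hr))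
  have hi := hχ.integrable_mul hc hk hF
  rw [← integral_indicator Metric.isClosed_closedBall.measurableSet]
  refine integral_mono ?_ hi fun x => ?_
  · exact (hF.norm.continuousOn.integrableOn_compact
      (isCompact_closedBall _ _)).integrable_indicator Metric.isClosed_closedBall.measurableSet
  · by_cases hx : x ∈ Metric.closedBall (0 : EuclideanSpace ℝ (Fin n)) r
    · rw [Set.indicator_of_mem hx]
      rw [mem_closedBall_zero_iff] at hx
      dsimp only
      rw [h₁ ((1 / r) • x), one_pow, one_mul, Real.norm_of_nonneg (hF0 x)]
      rw [norm_smul, Real.norm_of_nonneg hc.le, one_div_mul_eq_div, div_le_one hr0]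
      exact hx
    · rw [Set.indicator_of_notMem hx]
      exact mul_nonneg (pow_nonneg (hχ.nonneg _) _) (hF0 x)

lemma IsCutoff.tendsto_integral (hχ : IsCutoff χ) (h₁ : ∀ x, ‖x‖ ≤ 1 → χ x = 1)
    {F : EuclideanSpace ℝ (Fin n) → ℝ} (hF : Integrable F) (k : ℕ) :
    Filter.Tendsto (fun c : ℝ => ∫ x, χ (c • x) ^ k * F x) (nhdsWithin 0 (Set.Ioi 0))
      (nhds (∫ x, F x)) := by
  refine tendsto_integral_filter_of_dominated_convergence (fun x => ‖F x‖)
    (.of_forall fun c =>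
      (hχ.contDiff_smul_pow c k).continuous.aestronglyMeasurable.mul hF.aestronglyMeasurable)
    (.of_forall fun c => .of_forall fun x => ?_) hF.norm (.of_forall fun x => ?_)
  · rw [norm_mul, Real.norm_of_nonneg (pow_nonneg (hχ.nonneg _) _)]
    exact mul_le_of_le_one_left (norm_nonneg _) (pow_le_one₀ (hχ.nonneg _) (hχ.le_one _))
  · have hcont : Continuous fun c : ℝ => χ (c • x) ^ k * F x :=
      ((hχ.smooth.continuous.comp (continuous_id.smul continuous_const)).pow k).mul
        continuous_const
    have h := (hcont.tendsto 0).mono_left (nhdsWithin_le_nhds (s := Set.Ioi 0))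
    rwa [zero_smul, h₁ 0 (by simp), one_pow, one_mul] at h

end Limits
lemma exists_isCutoff (n : ℕ) : ∃ χ : EuclideanSpace ℝ (Fin n) → ℝ, IsCutoff χ ∧
    (∀ x, ‖x‖ ≤ 1 → χ x = 1) ∧ ∀ x, 2 ≤ ‖x‖ → χ x = 0 := by
  let f : ContDiffBump (0 : EuclideanSpace ℝ (Fin n)) := ⟨1, 2, one_pos, one_lt_two⟩
  refine ⟨f, ⟨f.contDiff, f.hasCompactSupport, fun _ => f.nonneg, fun _ => f.le_one⟩,
    fun x hx => f.one_of_mem_closedBall (mem_closedBall_zero_iff.2 hx), fun x hx => ?_⟩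
  exact f.zero_of_le_dist (by rwa [dist_zero_right])

section Young

variable {n : ℕ} {p : ℝ}

lemma young_weighted (hn : 9 ≤ n) (hp : p = ((n : ℝ) + 8) / ((n : ℝ) - 8)) {l c w : ℝ}
    (hl : 0 < l) (hc : 0 < c) (hw : 0 ≤ w) (hw₁ : w ≤ 1) (a : ℝ) :
    c ^ 8 * (w ^ (2 * n) * a ^ 2) ≤
      l ^ ((n : ℝ) / (n - 8)) * (w ^ (2 * n + 8) * |a| ^ (p + 1)) +
        l ^ (-((n : ℝ) / 8)) * (c ^ n * w) := by
  have hn' : (9 : ℝ) ≤ n := by exact_mod_cast hn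
  have hn8 : (0 : ℝ) < n - 8 := by linarith
  set q : ℝ := (n : ℝ) / (n - 8) with hq
  set q' : ℝ := (n : ℝ) / 8 with hq'
  have hq1 : 1 ≤ q := by rw [hq, one_le_div hn8]; linarith
  have hq1' : 1 ≤ q' := by rw [hq', one_le_div (by norm_num)]; linarith
  have hqq : q.HolderConjugate q' := by
    rw [Real.holderConjugate_iff]
    refine ⟨by rw [hq, one_lt_div hn8]; linarith, ?_⟩
    rw [hq, hq']
    field_simp
    ring
  obtain ⟨m, hm⟩ : ∃ m, 2 * n = m + 1 := ⟨2 * n - 1, by omega⟩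
  have hmr : (m : ℝ) = 2 * n - 1 := by
    have : (2 * n : ℝ) = m + 1 := by exact_mod_cast hm
    linarith
  have hpq : p + 1 = 2 * q := by
    rw [hp, hq]
    field_simp
    ring
  have hY := Real.young_inequality_of_nonneg (a := l * (w ^ m * a ^ 2)) (b := c ^ 8 / l)
    (by positivity) (by positivity) hqq
  have hX : (l * (w ^ m * a ^ 2)) ^ q = l ^ q * (w ^ ((m : ℝ) * q) * |a| ^ (p + 1)) := by
    rw [Real.mul_rpow hl.le (by positivity), Real.mul_rpow (by positivity) (by positivity),
      ← Real.rpow_natCast_mul hw, ← sq_abs a, ← Real.rpow_natCast_mul (abs_nonneg a), hpq]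
    norm_num
  have hZ : (c ^ 8 / l) ^ q' = l ^ (-q') * c ^ n := by
    rw [Real.div_rpow (by positivity) hl.le, ← Real.rpow_natCast_mul hc.le, Real.rpow_neg hl.le,
      hq', show ((8 : ℕ) : ℝ) * ((n : ℝ) / 8) = n by push_cast; ring, Real.rpow_natCast,
      div_eq_inv_mul]
  rw [hX, hZ] at hY
  have hwm : w ^ ((m : ℝ) * q) ≤ w ^ (2 * n + 7) := by
    rw [← Real.rpow_natCast w (2 * n + 7)]
    refine Real.rpow_le_rpow_of_exponent_ge' hw hw₁ (by positivity) ?_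
    rw [hmr, hq, mul_div_assoc', le_div_iff₀ hn8]
    push_cast
    nlinarith
  have hP : 0 ≤ l ^ q * (w ^ ((m : ℝ) * q) * |a| ^ (p + 1)) := by positivity
  have hQ : 0 ≤ l ^ (-q') * c ^ n := by positivity
  have h1 := div_le_self hP hq1
  have h2 := div_le_self hQ hq1'
  have h3 : l ^ q * (w ^ ((m : ℝ) * q) * |a| ^ (p + 1)) ≤
      l ^ q * (w ^ (2 * n + 7) * |a| ^ (p + 1)) := by gcongr
  have e : l * (w ^ m * a ^ 2) * (c ^ 8 / l) = w ^ m * a ^ 2 * c ^ 8 := by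
    field_simp
  rw [e] at hY
  have h4 := mul_le_mul_of_nonneg_left (hY.trans (add_le_add (h1.trans h3) h2)) hw
  rw [hm]
  refine le_trans (le_of_eq (by ring)) (h4.trans (le_of_eq ?_))
  rw [show m + 1 + 8 = 2 * n + 7 + 1 by omega]
  ring

variable {χ u : EuclideanSpace ℝ (Fin n) → ℝ}

lemma IsCutoff.integrable_weights (hχ : IsCutoff χ) (hn : 9 ≤ n) (hp : 0 ≤ p + 1)
    (hu : Continuous u) {c : ℝ} (hc : 0 < c) :
    Integrable (fun x => χ (c • x) ^ (2 * n) * u x ^ 2) ∧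
    Integrable (fun x => χ (c • x) ^ (2 * n + 8) * |u x| ^ (p + 1)) ∧
    Integrable (fun x => c ^ n * χ (c • x)) := by
  refine ⟨hχ.integrable_mul hc (by omega) (hu.pow 2), hχ.integrable_mul hc (by omega)
    (hu.abs.rpow_const fun _ => .inr hp), Integrable.const_mul ?_ _⟩
  have := hχ.integrable_mul hc le_rfl (h := fun _ => 1) continuous_const
  simpa using this

lemma IsCutoff.exists_zeroth_order_le (hχ : IsCutoff χ) (hn : 9 ≤ n)
    (hp : p = ((n : ℝ) + 8) / ((n : ℝ) - 8)) (hp₁ : 0 ≤ p + 1) (hu : Continuous u) {t : ℝ}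
    (ht : 0 < t) :
    ∃ C, 0 ≤ C ∧ ∀ c : ℝ, 0 < c → c ^ 8 * (∫ x, χ (c • x) ^ (2 * n) * u x ^ 2) ≤
      t * (∫ x, χ (c • x) ^ (2 * n + 8) * |u x| ^ (p + 1)) + C := by
  have hn' : (9 : ℝ) ≤ n := by exact_mod_cast hn
  have hq : (n : ℝ) / (n - 8) ≠ 0 := (div_pos (by linarith) (by linarith)).ne'
  set l : ℝ := t ^ (((n : ℝ) / (n - 8))⁻¹) with hl
  have hl0 : 0 < l := Real.rpow_pos_of_pos ht _
  have hlt : l ^ ((n : ℝ) / (n - 8)) = t := Real.rpow_inv_rpow ht.le hq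
  refine ⟨l ^ (-((n : ℝ) / 8)) * ∫ x, χ x, mul_nonneg (by positivity)
    (integral_nonneg fun x => hχ.nonneg x), fun c hc => ?_⟩
  obtain ⟨i₁, i₂, i₃⟩ := hχ.integrable_weights hn hp₁ hu hc
  have h := integral_le_of_le_linear_comb (a₁ := l ^ ((n : ℝ) / (n - 8)))
    (a₂ := l ^ (-((n : ℝ) / 8))) (a₃ := 0) (i₁.const_mul (c ^ 8)) i₂ i₃ i₃ fun x =>
    (young_weighted hn hp hl0 hc (hχ.nonneg (c • x)) (hχ.le_one _) (u x)).trans_eq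
      (by rw [zero_mul, add_zero])
  rw [integral_const_mul, integral_pow_mul_comp_smul hc, hlt] at h
  linarith

lemma IsCutoff.tendsto_zeroth_order (hχ : IsCutoff χ) (hn : 9 ≤ n)
    (hp : p = ((n : ℝ) + 8) / ((n : ℝ) - 8)) (hp₁ : 0 ≤ p + 1) (hu : Continuous u)
    (hi : Integrable fun x => |u x| ^ (p + 1)) :
    Filter.Tendsto (fun c : ℝ => c ^ 8 * (∫ x, χ (c • x) ^ (2 * n) * u x ^ 2))
      (nhdsWithin 0 (Set.Ioi 0)) (nhds 0) := by
  have hn' : (9 : ℝ) ≤ n := by exact_mod_cast hn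
  have hM : 0 ≤ ∫ x, χ x := integral_nonneg fun x => hχ.nonneg x
  have hw : ∀ (c : ℝ) x j, 0 ≤ χ (c • x) ^ j := fun c x j => pow_nonneg (hχ.nonneg _) j
  have hw₁ : ∀ (c : ℝ) x j, χ (c • x) ^ j ≤ 1 := fun c x j =>
    pow_le_one₀ (hχ.nonneg _) (hχ.le_one _)
  refine tendsto_order.2 ⟨fun b hb => ?_, fun b hb => ?_⟩
  · filter_upwards [self_mem_nhdsWithin] with c hc
    exact hb.trans_le (mul_nonneg (by positivity)
      (integral_nonneg fun x => mul_nonneg (hw _ _ _) (sq_nonneg _)))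
  set t : ℝ := b / (2 * ((∫ x, χ x) + 1)) with ht
  have ht0 : 0 < t := by positivity
  set l : ℝ := (t ^ (((n : ℝ) / 8)⁻¹))⁻¹ with hl
  have hl0 : 0 < l := inv_pos.2 (Real.rpow_pos_of_pos ht0 _)
  have hlt : l ^ (-((n : ℝ) / 8)) = t := by
    rw [hl, Real.inv_rpow (by positivity), Real.rpow_neg (by positivity), inv_inv,
      Real.rpow_inv_rpow ht0.le (by positivity)]
  set A := l ^ ((n : ℝ) / (n - 8))
  have hA : 0 ≤ A := by positivity
  set f : ℝ → EuclideanSpace ℝ (Fin n) → ℝ := fun c x =>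
    max (c ^ 8 * (χ (c • x) ^ (2 * n) * u x ^ 2) - t * (c ^ n * χ (c • x))) 0 with hf
  have hfc : ∀ c, Continuous (f c) := fun c =>
    ((continuous_const.mul ((hχ.contDiff_smul_pow c (2 * n)).continuous.mul (hu.pow 2))).sub
      (continuous_const.mul (continuous_const.mul
        (contDiff_comp_smul c hχ.smooth).continuous))).max continuous_const
  have hfle : ∀ c : ℝ, 0 < c → ∀ x, ‖f c x‖ ≤ A * |u x| ^ (p + 1) := by
    intro c hc x
    rw [Real.norm_of_nonneg (le_max_right _ _)]
    refine max_le ?_ (by positivity)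
    have h := young_weighted hn hp hl0 hc (hχ.nonneg (c • x)) (hχ.le_one _) (u x)
    rw [hlt] at h
    have h2 : A * (χ (c • x) ^ (2 * n + 8) * |u x| ^ (p + 1)) ≤ A * |u x| ^ (p + 1) :=
      mul_le_mul_of_nonneg_left (mul_le_of_le_one_left (by positivity) (hw₁ _ _ _)) hA
    linarith
  have hlim : Filter.Tendsto (fun c : ℝ => ∫ x, f c x) (nhdsWithin 0 (Set.Ioi 0))
      (nhds (∫ _ : EuclideanSpace ℝ (Fin n), (0 : ℝ))) := by
    refine tendsto_integral_filter_of_dominated_convergence (fun x => A * |u x| ^ (p + 1))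
      (.of_forall fun c => (hfc c).aestronglyMeasurable) ?_ (hi.const_mul A)
      (.of_forall fun x => ?_)
    · filter_upwards [self_mem_nhdsWithin] with c hc
      exact .of_forall (hfle c hc)
    · have h0 : Filter.Tendsto (fun c : ℝ => c ^ 8 * u x ^ 2) (nhdsWithin 0 (Set.Ioi 0))
          (nhds 0) := by
        have : Continuous fun c : ℝ => c ^ 8 * u x ^ 2 := by fun_prop
        have h := (this.tendsto 0).mono_left (nhdsWithin_le_nhds (s := Set.Ioi 0))
        simpa using h
      refine tendsto_of_tendsto_of_tendsto_of_le_of_le' tendsto_const_nhds h0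
        (.of_forall fun c => le_max_right _ _) ?_
      filter_upwards [self_mem_nhdsWithin] with c hc
      have hc' : 0 < c := hc
      refine max_le ?_ (by positivity)
      have h1 : c ^ 8 * (χ (c • x) ^ (2 * n) * u x ^ 2) ≤ c ^ 8 * u x ^ 2 :=
        mul_le_mul_of_nonneg_left (mul_le_of_le_one_left (sq_nonneg _) (hw₁ _ _ _))
          (by positivity)
      have h2 : 0 ≤ t * (c ^ n * χ (c • x)) :=
        mul_nonneg ht0.le (mul_nonneg (by positivity) (hχ.nonneg _))
      linarith
  rw [integral_zero] at hlim
  filter_upwards [self_mem_nhdsWithin, hlim.eventually (gt_mem_nhds (half_pos hb))] with c hc hcb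
  have hc' : 0 < c := hc
  obtain ⟨i₁, -, i₃⟩ := hχ.integrable_weights hn hp₁ hu hc'
  have hfi : Integrable (f c) :=
    (hi.const_mul A).mono' (hfc c).aestronglyMeasurable (.of_forall (hfle c hc'))
  have h := integral_le_of_le_linear_comb (a₁ := 1) (a₂ := t) (a₃ := 0)
    (i₁.const_mul (c ^ 8)) hfi i₃ i₃ fun x => by
      have := le_max_left (c ^ 8 * (χ (c • x) ^ (2 * n) * u x ^ 2) - t * (c ^ n * χ (c • x))) 0
      simp only [hf]
      linarith
  rw [integral_const_mul, integral_pow_mul_comp_smul hc'] at h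
  have htM : t * ∫ x, χ x ≤ b / 2 := by
    rw [ht, div_mul_eq_mul_div, div_le_div_iff₀ (by positivity) two_pos]
    nlinarith
  linarith

end Young

/-- A solution of `Δ⁴ u = |u|^{p-1} u` in `ℝⁿ` with `p = (n+8)/(n-8)` that is stable
outside a compact set has finite energy: `∫ |Δ²u|² = ∫ |u|^{p+1} < ∞`. -/
theorem quadharmonic_LaneEmden_stable_outside_compact_critical_finite_energy
    (n : ℕ) (hn : 9 ≤ n) (p : ℝ) (hp : p = ((n : ℝ) + 8) / ((n : ℝ) - 8))
    (u : EuclideanSpace ℝ (Fin n) → ℝ) (hu : ContDiff ℝ (⊤ : ℕ∞) u)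
    (heq : ∀ x, lap^[4] u x = |u x| ^ (p - 1) * u x)
    (hstable : ∃ K : Set (EuclideanSpace ℝ (Fin n)), IsCompact K ∧
      ∀ φ : EuclideanSpace ℝ (Fin n) → ℝ, ContDiff ℝ (⊤ : ℕ∞) φ → HasCompactSupport φ →
        tsupport φ ⊆ Kᶜ →
        p * ∫ x, |u x| ^ (p - 1) * (φ x) ^ 2 ≤ ∫ x, (lap^[2] φ x) ^ 2) :
    Integrable (fun x => (lap^[2] u x) ^ 2) ∧
    Integrable (fun x => |u x| ^ (p + 1)) ∧
    ∫ x, (lap^[2] u x) ^ 2 = ∫ x, |u x| ^ (p + 1) := by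
  obtain ⟨K, hK, hs⟩ := hstable
  obtain ⟨χ, hχ, h₁, h₂⟩ := exists_isCutoff n
  have hn' : (9 : ℝ) ≤ n := by exact_mod_cast hn
  have hp1 : 1 < p := by rw [hp, one_lt_div (by linarith)]; linarith
  have hp₁ : 0 ≤ p + 1 := by linarith
  have hpow : ∀ a : ℝ, |a| ^ (p - 1) * a ^ 2 = |a| ^ (p + 1) := fun a => by
    rw [← sq_abs, ← Real.rpow_natCast, ← Real.rpow_add_of_nonneg (abs_nonneg a) (by linarith)
      (by norm_num)]
    congr 1
    push_cast
    ring
  have heq' : ∀ x, lap (lap (lap (lap u))) x * u x = |u x| ^ (p + 1) := fun x => by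
    rw [← hpow, sq, ← mul_assoc]
    exact congrArg (· * u x) (heq x)
  have hLc : Continuous fun x => lap (lap u) x ^ 2 :=
    (contDiff_lap (contDiff_lap hu)).continuous.pow 2
  have huc : Continuous fun x => |u x| ^ (p + 1) :=
    hu.continuous.abs.rpow_const fun _ => .inr hp₁
  have hVc : Continuous fun x => p * |u x| ^ (p - 1) :=
    continuous_const.mul (hu.continuous.abs.rpow_const fun _ => .inr (by linarith))
  set E : ℝ → ℝ := fun c => ∫ x, χ (c • x) ^ (2 * n + 8) * |u x| ^ (p + 1) with hE
  set A : ℝ → ℝ := fun c => ∫ x, χ (c • x) ^ (2 * n + 8) * lap (lap u) x ^ 2 with hA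
  set Z : ℝ → ℝ := fun c => c ^ 8 * ∫ x, χ (c • x) ^ (2 * n) * u x ^ 2 with hZ
  have henergy : ∀ ε : ℝ, 0 < ε → ∃ C, 0 ≤ C ∧ ∀ c, 0 < c → |A c - E c| ≤ ε * A c + C * Z c := by
    intro ε hε
    obtain ⟨C, hC, H⟩ := hχ.abs_energy_sub_le (k := n) (by omega) hε
    refine ⟨C, hC, fun c hc => ?_⟩
    have h := H c hc u hu
    simp only [heq'] at h
    exact h
  obtain ⟨C₀, c₀, hc₀, hst⟩ := hχ.exists_stability_bound h₁ h₂ hVc hu hK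
    (fun φ hφ hφc hφs => by
      have h := hs φ hφ hφc hφs
      rw [← integral_const_mul] at h
      simp only [mul_assoc]
      exact h) (m := n + 4) (by omega)
  set δ : ℝ := (p - 1) / (2 * (p + 1)) with hδ
  have hp1' : 0 < p - 1 := by linarith
  have hp₁' : 0 < p + 1 := by linarith
  have hδ0 : 0 < δ := by positivity
  have hδp : δ * (p + 1) = (p - 1) / 2 := by
    rw [hδ]
    field_simp
  have hδ1 : δ < 1 := by
    rw [hδ, div_lt_one (by positivity)]
    linarith
  obtain ⟨C₁, hC₁, H₁⟩ := henergy δ hδ0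
  obtain ⟨C₂, hC₂, H₂⟩ := hχ.integral_sq_lap_lap_mul_le (k := n) (by omega) hδ0
  have hstE : ∀ c, 0 < c → c < c₀ → p * E c ≤ (1 + δ) * A c + C₂ * Z c + C₀ := by
    intro c hc hcc
    have h := hst c hc hcc
    have e : ∫ x, p * |u x| ^ (p - 1) * (χ (c • x) ^ (n + 4) * u x) ^ 2 = p * E c := by
      rw [hE]
      dsimp only
      rw [← integral_const_mul]
      refine integral_congr_ae (.of_forall fun x => ?_)
      dsimp only
      rw [← hpow]
      ring
    rw [e] at h
    have := H₂ c hc u hu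
    linarith
  obtain ⟨C₃, hC₃, H₃⟩ := hχ.exists_zeroth_order_le hn hp hp₁ hu.continuous
    (t := (p - 1) / (4 * ((1 + δ) * C₁ + C₂ + 1))) (by positivity)
  have hE0 : ∀ c, 0 ≤ E c := fun c => integral_nonneg fun x =>
    mul_nonneg (pow_nonneg (hχ.nonneg _) _) (by positivity)
  have hZ0 : ∀ c, 0 ≤ Z c := fun c => mul_nonneg (by positivity) (integral_nonneg fun x =>
    mul_nonneg (pow_nonneg (hχ.nonneg _) _) (by positivity))
  have hAE : ∀ c, 0 < c → (1 - δ) * A c ≤ E c + C₁ * Z c := fun c hc => by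
    have h := (abs_le.1 (H₁ c hc)).2
    linarith
  set t : ℝ := (p - 1) / (4 * ((1 + δ) * C₁ + C₂ + 1)) with ht
  have ht0 : 0 < t := by positivity
  have hEb : ∀ c, 0 < c → c < c₀ →
      (p - 1) / 4 * E c ≤ ((1 + δ) * C₁ + C₂) * C₃ + |C₀| := by
    intro c hc hcc
    have a₁ := mul_le_mul_of_nonneg_left (hstE c hc hcc) (show 0 ≤ 1 - δ by linarith)
    have a₂ := mul_le_mul_of_nonneg_left (hAE c hc) (show 0 ≤ 1 + δ by linarith)
    have a₃ : (1 - δ) * (C₂ * Z c) ≤ C₂ * Z c :=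
      mul_le_of_le_one_left (mul_nonneg hC₂ (hZ0 c)) (by linarith)
    have a₄ : (1 - δ) * C₀ ≤ |C₀| :=
      (mul_le_mul_of_nonneg_left (le_abs_self C₀) (by linarith)).trans
        (mul_le_of_le_one_left (abs_nonneg _) (by linarith))
    have a₅ := mul_le_mul_of_nonneg_left (H₃ c hc) (show 0 ≤ (1 + δ) * C₁ + C₂ by positivity)
    have a₆ : ((1 + δ) * C₁ + C₂) * t ≤ (p - 1) / 4 := by
      have : 0 ≤ (1 + δ) * C₁ + C₂ := by positivity
      rw [ht, mul_div_assoc', div_le_div_iff₀ (by positivity) (by norm_num)]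
      nlinarith
    have a₇ := mul_le_mul_of_nonneg_right a₆ (hE0 c)
    have a₈ : δ * (p + 1) * E c = (p - 1) / 2 * E c := by rw [hδp]
    simp only [hZ, hE] at *
    linarith
  set B : ℝ := (((1 + δ) * C₁ + C₂) * C₃ + |C₀|) / ((p - 1) / 4) with hB
  have hEB : ∀ c, 0 < c → c < c₀ → E c ≤ B := fun c hc hcc => by
    rw [hB, le_div_iff₀ (by positivity), mul_comm]
    exact hEb c hc hcc
  have hAB : ∀ c, 0 < c → c < c₀ → A c ≤ (B + C₁ * (t * B + C₃)) / (1 - δ) := by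
    intro c hc hcc
    rw [le_div_iff₀ (by linarith), mul_comm]
    have b₁ := hEB c hc hcc
    have b₂ : Z c ≤ t * B + C₃ := (H₃ c hc).trans (by gcongr)
    have b₃ := mul_le_mul_of_nonneg_left b₂ hC₁
    have := hAE c hc
    linarith
  have iE := hχ.integrable_of_bound h₁ huc (fun x => by positivity) (by omega) hc₀ hEB
  have iA := hχ.integrable_of_bound h₁ hLc (fun x => by positivity) (by omega) hc₀ hAB
  refine ⟨iA, iE, ?_⟩
  have tE : Filter.Tendsto E _ _ := hχ.tendsto_integral h₁ iE (2 * n + 8)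
  have tA : Filter.Tendsto A _ _ := hχ.tendsto_integral h₁ iA (2 * n + 8)
  have tZ := hχ.tendsto_zeroth_order hn hp hp₁ hu.continuous iE
  have hlim : ∀ ε : ℝ, 0 < ε → |(∫ x, lap (lap u) x ^ 2) - ∫ x, |u x| ^ (p + 1)| ≤
      ε * ∫ x, lap (lap u) x ^ 2 := by
    intro ε hε
    obtain ⟨C, hC, H⟩ := henergy ε hε
    have hr := (tA.const_mul ε).add (tZ.const_mul C)
    rw [mul_zero, add_zero] at hr
    refine le_of_tendsto_of_tendsto (tA.sub tE).abs hr ?_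
    filter_upwards [self_mem_nhdsWithin] with c hc
    exact H c hc
  have hzero : |(∫ x, lap (lap u) x ^ 2) - ∫ x, |u x| ^ (p + 1)| ≤ 0 := by
    refine ge_of_tendsto (x := nhdsWithin (0 : ℝ) (Set.Ioi 0))
      (f := fun ε : ℝ => ε * ∫ x, lap (lap u) x ^ 2) ?_ ?_
    · have : Continuous fun ε : ℝ => ε * ∫ x, lap (lap u) x ^ 2 := by fun_prop
      have h := (this.tendsto 0).mono_left (nhdsWithin_le_nhds (s := Set.Ioi 0))
      simpa using h
    · filter_upwards [self_mem_nhdsWithin] with ε hε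
      exact hlim ε hε
  exact sub_eq_zero.1 (abs_nonpos_iff.1 hzero)
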